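/- arXiv:2211.07020 — 2 statements merged into one kernel-verified Lean document; each statement's English description precedes it below -/
import Mathlib

section
/- Let N_G := n + |E(G)| where E(G) is the edge set of G, and let R_G := R/(Z) (a polynomial ring in N_G variables). For every integer d ≥ 0, the K-vector-space dimension of the degree-d homogeneous component of R_G/(I_{n-1}(X_G)·R_G) equals C(d+N_G−1, N_G−1) − (C(n+1,2) − D_G)·C(d−n+N_G, N_G−1) + (n²−1−2·D_G)·C(d−n+N_G−1, N_G−1) − (C(n,2) − D_G)·C(d−n+N_G−2, N_G−1), where C(a,b) denotes the binomial coefficient with the convention C(a,b) = 0 whenever a < b (in particular whenever a < 0). -/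
open MvPolynomial
open scoped Classical

/-- The polynomial ring `R = K[x_{ij} : 1 ≤ i ≤ j ≤ n]`, realized as the multivariate
polynomial ring whose variables are indexed by unordered pairs of elements of `Fin n`
(so that `x_{ij} = x_{ji}` automatically). -/
abbrev SymPolyRing (K : Type*) [Field K] (n : ℕ) := MvPolynomial (Sym2 (Fin n)) K


/-- The sparse generic symmetric `n × n` matrix `X_G` associated to a simple graph `G`
on `[n]`: its `(i,j)` entry is the variable `x_{ij}` if `i = j` or `ij` is an edge of `G`,
and `0` otherwise (i.e. all variables in `Z` are replaced by `0`). -/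
noncomputable def sparseGenericSym (K : Type*) [Field K] (n : ℕ) (G : SimpleGraph (Fin n)) :
    Matrix (Fin n) (Fin n) (SymPolyRing K n) :=
  fun i j => if i = j ∨ G.Adj i j then MvPolynomial.X s(i, j) else 0


/-- The ideal of `k × k` minors of a square matrix `M` over a commutative ring: it is
generated by the determinants of all `k × k` submatrices of `M` (given by choosing `k`
distinct rows and `k` distinct columns). -/
noncomputable def minorsIdeal {R : Type*} [CommRing R] {n : ℕ} (k : ℕ)
    (M : Matrix (Fin n) (Fin n) R) : Ideal R :=
  Ideal.span { d | ∃ f g : Fin k → Fin n,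
    Function.Injective f ∧ Function.Injective g ∧ d = (M.submatrix f g).det }


/-- The invariant `D_G = Σ_{s<t} |C_s|·|C_t|` of a graph `G`, where `C_1, …, C_r` are the
vertex sets of the connected components of `G`; equivalently, `D_G` is the number of
unordered pairs of vertices of `G` lying in two different connected components. -/
noncomputable def DG {n : ℕ} (G : SimpleGraph (Fin n)) : ℕ :=
  Nat.card {p : Fin n × Fin n // p.1 < p.2 ∧ ¬ G.Reachable p.1 p.2}

/-- The binomial coefficient `C(a, b)` for integers, with the convention that
`C(a, b) = 0` whenever `a < b` (in particular whenever `a < 0`). -/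
def intChoose (a b : ℤ) : ℤ :=
  if a < b then 0 else (a.toNat.choose b.toNat : ℤ)

/-- The dimension over `K` of the degree-`d` homogeneous component of the quotient of
`MvPolynomial σ K` by a (homogeneous) ideal `J`: the degree-`d` homogeneous component of
the quotient ring is the quotient of the space of homogeneous polynomials of degree `d`
by the subspace of those lying in `J`. -/
noncomputable def quotientComponentDim (K : Type*) [Field K] {σ : Type*}
    (J : Ideal (MvPolynomial σ K)) (d : ℕ) : ℕ :=
  Module.finrank K
    ((homogeneousSubmodule σ K d) ⧸
      ((Submodule.restrictScalars K J ⊓ homogeneousSubmodule σ K d).comap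
        (homogeneousSubmodule σ K d).subtype))



namespace SMin

section alt
variable {n : ℕ} {R : Type*} [CommRing R]

/-- Alternating matrices. -/
def Alt (A : Matrix (Fin n) (Fin n) R) : Prop := (∀ i, A i i = 0) ∧ ∀ i j, A i j = - A j i

lemma alt_iff (A : Matrix (Fin n) (Fin n) R) :
    Alt A ↔ ∃ U : Matrix (Fin n) (Fin n) R, A = U - U.transpose := by
  constructor
  · rintro ⟨h1, h2⟩
    refine ⟨Matrix.of fun i j => if i < j then A i j else 0, ?_⟩
    ext i j
    rcases lt_trichotomy i j with h | h | h
    · simp [Matrix.sub_apply, Matrix.transpose_apply, h, not_lt.mpr h.le]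
    · subst h; simp [Matrix.sub_apply, Matrix.transpose_apply, h1]
    · simp [Matrix.sub_apply, Matrix.transpose_apply, h, not_lt.mpr h.le, h2 i j]
  · rintro ⟨U, rfl⟩
    exact ⟨fun i => by simp, fun i j => by simp⟩

lemma Alt.zero : Alt (0 : Matrix (Fin n) (Fin n) R) := ⟨fun i => by simp, fun i j => by simp⟩

lemma Alt.add {A B : Matrix (Fin n) (Fin n) R} (hA : Alt A) (hB : Alt B) : Alt (A + B) :=
  ⟨fun i => by simp [hA.1, hB.1], fun i j => by
    rw [Matrix.add_apply, Matrix.add_apply, hA.2 i j, hB.2 i j]; ring⟩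

lemma Alt.sub {A B : Matrix (Fin n) (Fin n) R} (hA : Alt A) (hB : Alt B) : Alt (A - B) :=
  ⟨fun i => by simp [hA.1, hB.1], fun i j => by
    rw [Matrix.sub_apply, Matrix.sub_apply, hA.2 i j, hB.2 i j]; ring⟩

lemma Alt.smul {A : Matrix (Fin n) (Fin n) R} (c : R) (hA : Alt A) : Alt (c • A) :=
  ⟨fun i => by simp [hA.1], fun i j => by
    rw [Matrix.smul_apply, Matrix.smul_apply, hA.2 i j]; simp⟩

lemma Alt.map {R' : Type*} [CommRing R'] {F : Type*} [FunLike F R R'] [AddMonoidHomClass F R R']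
    {A : Matrix (Fin n) (Fin n) R} (f : F) (hA : Alt A) : Alt (A.map f) :=
  ⟨fun i => by simp [hA.1], fun i j => by
    rw [Matrix.map_apply, Matrix.map_apply, hA.2 i j]; simp⟩

lemma Alt.of_map {R' : Type*} [CommRing R'] {F : Type*} [FunLike F R R'] [AddMonoidHomClass F R R']
    {A : Matrix (Fin n) (Fin n) R} (f : F) (hf : Function.Injective f) (hA : Alt (A.map f)) :
    Alt A :=
  ⟨fun i => hf (by simpa using hA.1 i), fun i j => hf (by simpa using hA.2 i j)⟩

lemma Alt.of_smul [IsDomain R] {A : Matrix (Fin n) (Fin n) R} {c : R} (hc : c ≠ 0)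
    (hA : Alt (c • A)) : Alt A :=
  ⟨fun i => by simpa [hc] using hA.1 i, fun i j => by
    have := hA.2 i j
    simp only [Matrix.smul_apply, smul_eq_mul] at this
    exact mul_left_cancel₀ hc (by rw [this]; ring)⟩

lemma Alt.conj {A : Matrix (Fin n) (Fin n) R} (P : Matrix (Fin n) (Fin n) R) (hA : Alt A) :
    Alt (P.transpose * A * P) := by
  obtain ⟨U, rfl⟩ := (alt_iff A).1 hA
  refine (alt_iff _).2 ⟨P.transpose * U * P, ?_⟩
  simp only [Matrix.transpose_mul, Matrix.transpose_transpose, Matrix.mul_sub, Matrix.sub_mul,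
    Matrix.mul_assoc]

lemma trace_mul_alt {A X : Matrix (Fin n) (Fin n) R} (hX : X.IsSymm) (hA : Alt A) :
    (X * A).trace = 0 := by
  obtain ⟨U, rfl⟩ := (alt_iff A).1 hA
  rw [Matrix.mul_sub, Matrix.trace_sub, sub_eq_zero, ← Matrix.trace_transpose (X * U.transpose),
    Matrix.transpose_mul, Matrix.transpose_transpose, hX.eq, Matrix.trace_mul_comm]

/-- Block projection for a relation. -/
noncomputable def blk (r : Fin n → Fin n → Prop) (M : Matrix (Fin n) (Fin n) R) :
    Matrix (Fin n) (Fin n) R := fun i j => if r i j then M i j else 0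

/-- Block matrices. -/
def IsBlk (r : Fin n → Fin n → Prop) (M : Matrix (Fin n) (Fin n) R) : Prop :=
  ∀ i j, ¬ r i j → M i j = 0

variable {r : Fin n → Fin n → Prop}

lemma blk_isBlk (M : Matrix (Fin n) (Fin n) R) : IsBlk r (blk r M) := fun i j h => by
  simp [blk, h]

lemma IsBlk.blk_eq {M : Matrix (Fin n) (Fin n) R} (h : IsBlk r M) : blk r M = M := by
  ext i j
  by_cases hr : r i j <;> simp [blk, hr]
  rw [h i j hr]

lemma IsBlk.mul (hr : Equivalence r) {X B : Matrix (Fin n) (Fin n) R} (hX : IsBlk r X)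
    (hB : IsBlk r B) : IsBlk r (X * B) := fun i j h => by
  rw [Matrix.mul_apply]
  refine Finset.sum_eq_zero fun k _ => ?_
  by_cases h1 : r i k
  · rw [hB k j fun h2 => h (hr.trans h1 h2), mul_zero]
  · rw [hX i k h1, zero_mul]

lemma IsBlk.sub {X B : Matrix (Fin n) (Fin n) R} (hX : IsBlk r X)
    (hB : IsBlk r B) : IsBlk r (X - B) := fun i j h => by
  rw [Matrix.sub_apply, hX i j h, hB i j h, sub_zero]

lemma IsBlk.add {X B : Matrix (Fin n) (Fin n) R} (hX : IsBlk r X)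
    (hB : IsBlk r B) : IsBlk r (X + B) := fun i j h => by
  rw [Matrix.add_apply, hX i j h, hB i j h, add_zero]

lemma IsBlk.smul (c : R) {X : Matrix (Fin n) (Fin n) R} (hX : IsBlk r X) : IsBlk r (c • X) :=
  fun i j h => by rw [Matrix.smul_apply, hX i j h, smul_zero]

lemma IsBlk.map {R' : Type*} [CommRing R'] {F : Type*} [FunLike F R R'] [AddMonoidHomClass F R R']
    {A : Matrix (Fin n) (Fin n) R} (f : F) (hA : IsBlk r A) : IsBlk r (A.map f) :=
  fun i j h => by rw [Matrix.map_apply, hA i j h, map_zero]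

lemma blk_mul (hr : Equivalence r) {X : Matrix (Fin n) (Fin n) R} (hX : IsBlk r X)
    (B : Matrix (Fin n) (Fin n) R) : blk r (X * B) = X * blk r B := by
  ext i j
  simp only [blk, Matrix.mul_apply]
  split_ifs with h
  · refine Finset.sum_congr rfl fun k _ => ?_
    by_cases h1 : r i k
    · rw [if_pos (hr.trans (hr.symm h1) h)]
    · rw [hX i k h1, zero_mul, zero_mul]
  · refine (Finset.sum_eq_zero fun k _ => ?_).symm
    by_cases h1 : r i k
    · rw [if_neg fun h2 => h (hr.trans h1 h2), mul_zero]
    · rw [hX i k h1, zero_mul]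

lemma blk_sub (A B : Matrix (Fin n) (Fin n) R) : blk r (A - B) = blk r A - blk r B := by
  ext i j
  by_cases h : r i j <;> simp [blk, h]

lemma Alt.blk (hr : Equivalence r) {A : Matrix (Fin n) (Fin n) R} (hA : Alt A) :
    Alt (blk r A) :=
  ⟨fun i => by simp [SMin.blk, hA.1], fun i j => by
    by_cases h : r i j
    · simp only [SMin.blk, if_pos h, if_pos (hr.symm h), hA.2 i j]
    · simp only [SMin.blk, if_neg h, if_neg fun h' => h (hr.symm h'), neg_zero]⟩

lemma trace_blk (hr : Equivalence r) (A : Matrix (Fin n) (Fin n) R) :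
    (blk r A).trace = A.trace := by
  simp [Matrix.trace, blk, hr.refl]

lemma mul_right_inj_of_det [IsDomain R] {X A B : Matrix (Fin n) (Fin n) R} (hX : X.det ≠ 0)
    (h : X * A = X * B) : A = B := by
  have h2 : X.det • A = X.det • B := by
    have := congrArg (fun M => X.adjugate * M) h
    simpa only [← Matrix.mul_assoc, Matrix.adjugate_mul, Matrix.smul_mul, Matrix.one_mul] using this
  exact smul_right_injective _ hX h2

lemma mul_left_inj_of_det [IsDomain R] {X A B : Matrix (Fin n) (Fin n) R} (hX : X.det ≠ 0)
    (h : A * X = B * X) : A = B := by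
  have h2 : X.det • A = X.det • B := by
    have := congrArg (fun M => M * X.adjugate) h
    simpa only [Matrix.mul_assoc, Matrix.mul_adjugate, Matrix.mul_smul, Matrix.mul_one] using this
  exact smul_right_injective _ hX h2

lemma adjugate_isBlk [IsDomain R] (hr : Equivalence r) {X : Matrix (Fin n) (Fin n) R}
    (hX : IsBlk r X) (hd : X.det ≠ 0) : IsBlk r X.adjugate := by
  have h : blk r X.adjugate = X.adjugate := by
    apply mul_right_inj_of_det hd
    rw [← blk_mul hr hX, Matrix.mul_adjugate]
    apply IsBlk.blk_eq
    apply IsBlk.smul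
    intro i j h
    exact Matrix.one_apply_ne fun e => h (e ▸ hr.refl i)
  rw [← h]; exact blk_isBlk _

/-- `A` is automatically alternating if `X A X` is. -/
lemma alt_of_conj [IsDomain R] {X A : Matrix (Fin n) (Fin n) R} (hs : X.IsSymm) (hd : X.det ≠ 0)
    (h : Alt (X * A * X)) : Alt A := by
  have h1 := h.conj X.adjugate
  have h2 : X.adjugate.transpose * (X * A * X) * X.adjugate = X.det • X.det • A := by
    rw [hs.adjugate.eq]
    calc X.adjugate * (X * A * X) * X.adjugate = (X.adjugate * X) * A * (X * X.adjugate) := by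
          simp only [Matrix.mul_assoc]
      _ = _ := by simp [Matrix.adjugate_mul, Matrix.mul_adjugate]
  rw [h2] at h1
  exact (h1.of_smul hd).of_smul hd

end alt

section grading
variable {σ K : Type*} [Field K]

/-- homogeneous component indexed by integers. -/
noncomputable def hc (k : ℤ) : MvPolynomial σ K →ₗ[K] MvPolynomial σ K :=
  if 0 ≤ k then homogeneousComponent k.toNat else 0

lemma hc_nat (k : ℕ) : (hc (k : ℤ) : MvPolynomial σ K →ₗ[K] MvPolynomial σ K)
    = homogeneousComponent k := by simp [hc]

lemma hc_neg {k : ℤ} (h : k < 0) (p : MvPolynomial σ K) : hc k p = 0 := by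
  simp [hc, not_le.mpr h]

/-- homogeneous of integer degree. -/
noncomputable def gr (σ K : Type*) [Field K] (k : ℤ) : Submodule K (MvPolynomial σ K) :=
  if 0 ≤ k then homogeneousSubmodule σ K k.toNat else ⊥

lemma hc_mem (k : ℤ) (p : MvPolynomial σ K) : hc k p ∈ gr σ K k := by
  unfold hc gr
  split_ifs with h
  · exact homogeneousComponent_mem _ _
  · simp

lemma hc_of_mem {k : ℤ} {p : MvPolynomial σ K} (h : p ∈ gr σ K k) : hc k p = p := by
  unfold hc; unfold gr at h
  split_ifs with h0
  · rw [if_pos h0] at h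
    exact homogeneousComponent_eq_self h
  · rw [if_neg h0] at h
    simp only [Submodule.mem_bot] at h
    simp [h]

lemma gr_nat (k : ℕ) : gr σ K (k : ℤ) = homogeneousSubmodule σ K k := by simp [gr]

lemma gr_neg {k : ℤ} (h : k < 0) : gr σ K k = ⊥ := by simp [gr, not_le.mpr h]

lemma hc_mul {m : ℕ} {q : MvPolynomial σ K} (hq : q.IsHomogeneous m) (k : ℤ)
    (p : MvPolynomial σ K) : hc (m + k) (q * p) = q * hc k p := by
  have key : ∀ j : ℕ, homogeneousComponent j (q * p)
      = if m ≤ j then q * homogeneousComponent (j - m) p else 0 := by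
    intro j
    have h1 : ∀ i, homogeneousComponent j (q * homogeneousComponent i p)
        = if j = m + i then q * homogeneousComponent i p else 0 := fun i =>
      homogeneousComponent_of_mem (hq.mul (homogeneousComponent_isHomogeneous i p))
    conv_lhs => rw [← sum_homogeneousComponent p, Finset.mul_sum, map_sum]
    simp only [h1]
    split_ifs with hj
    · rw [Finset.sum_eq_single (j - m)]
      · rw [if_pos (by omega)]
      · intro b _ hb
        rw [if_neg (by omega)]
      · intro hb
        rw [if_pos (by omega), homogeneousComponent_eq_zero _ _ (by simp at hb; omega), mul_zero]
    · exact Finset.sum_eq_zero fun i _ => by rw [if_neg (by omega)]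
  unfold hc
  split_ifs with h1 h2 h2
  · rw [key, if_pos (by omega)]
    congr 2
    congr 1
    omega
  · rw [key, if_neg (by omega)]; simp
  · omega
  · simp

lemma gr_mul {m : ℕ} {q : MvPolynomial σ K} (hq : q.IsHomogeneous m) {k : ℤ}
    {p : MvPolynomial σ K} (hp : p ∈ gr σ K k) : q * p ∈ gr σ K (m + k) := by
  rw [← hc_of_mem hp, ← hc_mul hq]; exact hc_mem _ _

lemma sum_hc (p : MvPolynomial σ K) {N : ℕ} (h : p.totalDegree < N) :
    ∑ k ∈ Finset.range N, hc (k : ℤ) p = p := by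
  conv_rhs => rw [← sum_homogeneousComponent p]
  simp only [hc_nat]
  refine (Finset.sum_subset (fun x hx => ?_) fun x _ hx => ?_).symm
  · simp at hx ⊢; omega
  · apply homogeneousComponent_eq_zero; simp at hx; omega

variable {n : ℕ}

lemma hc_matmul {m : ℕ} {X : Matrix (Fin n) (Fin n) (MvPolynomial σ K)}
    (hX : ∀ i j, (X i j).IsHomogeneous m) (k : ℤ) (B : Matrix (Fin n) (Fin n) (MvPolynomial σ K)) :
    (X * B).map (hc (m + k)) = X * B.map (hc k) := by
  ext1 i j
  simp only [Matrix.map_apply, Matrix.mul_apply, map_sum, hc_mul (hX _ _)]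

lemma hc_matmul' {m : ℕ} {X : Matrix (Fin n) (Fin n) (MvPolynomial σ K)}
    (hX : ∀ i j, (X i j).IsHomogeneous m) (k : ℤ) (B : Matrix (Fin n) (Fin n) (MvPolynomial σ K)) :
    (B * X).map (hc (m + k)) = B.map (hc k) * X := by
  ext1 i j
  simp only [Matrix.map_apply, Matrix.mul_apply, map_sum]
  refine Finset.sum_congr rfl fun l _ => ?_
  rw [mul_comm, hc_mul (hX _ _), mul_comm]

lemma trace_hc (k : ℤ) (B : Matrix (Fin n) (Fin n) (MvPolynomial σ K)) :
    (B.map (hc k)).trace = hc k B.trace := by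
  simp [Matrix.trace, map_sum]

lemma exists_bound (M : Matrix (Fin n) (Fin n) (MvPolynomial σ K)) :
    ∃ N : ℕ, M = ∑ k ∈ Finset.range N, M.map (hc (k : ℤ)) := by
  refine ⟨(∑ i, ∑ j, (M i j).totalDegree) + 1, ?_⟩
  ext1 i j
  rw [Matrix.sum_apply]
  simp only [Matrix.map_apply]
  rw [sum_hc]
  have h1 : (M i j).totalDegree ≤ ∑ j, (M i j).totalDegree :=
    Finset.single_le_sum (f := fun j => (M i j).totalDegree) (fun _ _ => Nat.zero_le _)
      (Finset.mem_univ j)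
  have h2 : ∑ j, (M i j).totalDegree ≤ ∑ i, ∑ j, (M i j).totalDegree :=
    Finset.single_le_sum (f := fun i => ∑ j, (M i j).totalDegree) (fun _ _ => Nat.zero_le _)
      (Finset.mem_univ i)
  omega

lemma det_hom {X : Matrix (Fin n) (Fin n) (MvPolynomial σ K)} {w : Fin n → ℕ}
    (hX : ∀ i j, (X i j).IsHomogeneous (w i)) : X.det.IsHomogeneous (∑ i, w i) := by
  rw [Matrix.det_apply]
  refine IsHomogeneous.sum _ _ _ fun s _ => ?_
  rw [Units.smul_def, zsmul_eq_mul]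
  have h1 : (∏ i, X (s i) i).IsHomogeneous (∑ i, w (s i)) :=
    IsHomogeneous.prod _ _ _ fun i _ => hX _ _
  rw [Equiv.sum_comp s w] at h1
  have : (((Equiv.Perm.sign s : ℤˣ) : ℤ) : MvPolynomial σ K)
      = C ((((Equiv.Perm.sign s : ℤˣ) : ℤ)) : K) := by simp
  rw [this]
  exact h1.C_mul _

lemma adj_hom {X : Matrix (Fin n) (Fin n) (MvPolynomial σ K)}
    (hX : ∀ i j, (X i j).IsHomogeneous 1) (i j : Fin n) :
    (X.adjugate i j).IsHomogeneous (n - 1) := by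
  rw [Matrix.adjugate_apply]
  have := det_hom (X := X.updateRow j (Pi.single i 1)) (w := fun k => if k = j then 0 else 1)
    (fun k l => by
      by_cases h : k = j
      · subst h
        simp only [Matrix.updateRow_self, if_true]
        by_cases h2 : l = i
        · subst h2; simp [isHomogeneous_one]
        · simp [h2, isHomogeneous_zero]
      · simp only [Matrix.updateRow_ne h, if_neg h]; exact hX k l)
  convert this using 1
  rw [Finset.sum_ite, Finset.sum_const_zero, zero_add, Finset.sum_const, smul_eq_mul, mul_one,
    Finset.filter_ne', Finset.card_erase_of_mem (Finset.mem_univ _), Finset.card_univ,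
    Fintype.card_fin]

end grading
end SMin


namespace SMin

section del
variable {n : ℕ} {K : Type*} [Field K]

/-- sparse symmetric matrix with support `Q`. -/
noncomputable def XQ (K : Type*) [Field K] (Q : Set (Sym2 (Fin n))) :
    Matrix (Fin n) (Fin n) (MvPolynomial (Sym2 (Fin n)) K) :=
  Matrix.of fun i j => if s(i, j) ∈ Q then X s(i, j) else 0

lemma XQ_apply (Q : Set (Sym2 (Fin n))) (i j : Fin n) :
    XQ K Q i j = if s(i, j) ∈ Q then X s(i, j) else 0 := rfl

lemma XQ_hom (Q : Set (Sym2 (Fin n))) (i j : Fin n) : (XQ K Q i j).IsHomogeneous 1 := by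
  rw [XQ_apply]
  split_ifs
  · exact isHomogeneous_X _ _
  · exact isHomogeneous_zero _ _ _

lemma XQ_symm (Q : Set (Sym2 (Fin n))) : (XQ K Q).IsSymm := by
  ext i j
  rw [Matrix.transpose_apply, XQ_apply, XQ_apply, Sym2.eq_swap]

/-- killing one variable. -/
noncomputable def phi {σ : Type*} (K : Type*) [Field K] (e : σ) :
    MvPolynomial σ K →ₐ[K] MvPolynomial σ K :=
  aeval fun f => if f = e then 0 else X f

lemma phi_X {σ : Type*} (e f : σ) : phi K e (X f) = if f = e then 0 else X f := by
  simp [phi]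

lemma phi_phi {σ : Type*} (e : σ) (p : MvPolynomial σ K) : phi K e (phi K e p) = phi K e p := by
  have : (phi K e).comp (phi K e) = phi K e := by
    apply MvPolynomial.algHom_ext
    intro f
    simp only [AlgHom.comp_apply, phi_X]
    split_ifs with h
    · simp
    · simp [phi_X, h]
  exact DFunLike.congr_fun this p

lemma X_dvd_sub_phi {σ : Type*} (e : σ) (p : MvPolynomial σ K) : X e ∣ p - phi K e p := by
  induction p using MvPolynomial.induction_on with
  | C a => simp [phi]
  | add p q hp hq =>
    rw [map_add]
    have := dvd_add hp hq
    convert this using 1; ring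
  | mul_X p f hp =>
    rw [map_mul, phi_X]
    split_ifs with h
    · subst h; simp
    · rw [← sub_mul]; exact dvd_mul_of_dvd_left hp _

lemma phi_gr {σ : Type*} (e : σ) {k : ℤ} {p : MvPolynomial σ K} (h : p ∈ gr σ K k) :
    phi K e p ∈ gr σ K k := by
  unfold gr at *
  split_ifs with h0
  · rw [if_pos h0] at h
    have := IsHomogeneous.aeval (n := 1) h (fun f => if f = e then (0 : MvPolynomial σ K) else X f)
      (fun i => by
        split_ifs
        · exact isHomogeneous_zero _ _ _
        · exact isHomogeneous_X _ _)
    rw [one_mul] at this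
    exact this
  · rw [if_neg h0] at h
    simp only [Submodule.mem_bot] at h ⊢
    simp [h]

lemma phi_XQ {e : Sym2 (Fin n)} {Q : Set (Sym2 (Fin n))} (he : e ∉ Q) :
    (XQ K (insert e Q)).map (phi K e) = XQ K Q := by
  ext1 i j
  rw [Matrix.map_apply, XQ_apply, XQ_apply]
  by_cases h : s(i, j) = e
  · rw [if_pos (show s(i, j) ∈ insert e Q from Set.mem_insert_iff.2 (Or.inl h)), phi_X, if_pos h, if_neg (h ▸ he)]
  · by_cases h2 : s(i, j) ∈ Q
    · rw [if_pos (show s(i, j) ∈ insert e Q from Set.mem_insert_of_mem _ h2), phi_X, if_neg h, if_pos h2]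
    · rw [if_neg (by simp [h, h2]), if_neg h2, map_zero]

/-- if `phi D = 0` and `D` is homogeneous then `D` is `X e` times something homogeneous. -/
lemma exists_factor {e : Sym2 (Fin n)}
    {D : Matrix (Fin n) (Fin n) (MvPolynomial (Sym2 (Fin n)) K)} (hD : D.map (phi K e) = 0) :
    ∃ B : Matrix (Fin n) (Fin n) (MvPolynomial (Sym2 (Fin n)) K), D = (X e : MvPolynomial _ K) • B := by
  have h : ∀ i j, ∃ b, D i j = X e * b := fun i j => by
    have h1 := X_dvd_sub_phi (K := K) e (D i j)
    have h2 : phi K e (D i j) = 0 := congrFun (congrFun hD i) j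
    rw [h2, sub_zero] at h1
    exact h1
  choose B hB using h
  exact ⟨Matrix.of B, by ext1 i j; simp [hB]⟩

lemma exists_factor_hom {e : Sym2 (Fin n)} {d : ℤ}
    {D : Matrix (Fin n) (Fin n) (MvPolynomial (Sym2 (Fin n)) K)} (hD : D.map (phi K e) = 0)
    (hd : ∀ i j, D i j ∈ gr _ K d) :
    ∃ B : Matrix (Fin n) (Fin n) (MvPolynomial (Sym2 (Fin n)) K),
      D = (X e : MvPolynomial _ K) • B ∧ ∀ i j, B i j ∈ gr _ K (d - 1) := by
  obtain ⟨B, hB⟩ := exists_factor hD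
  refine ⟨B.map (hc (d - 1)), ?_, fun i j => hc_mem _ _⟩
  ext1 i j
  rw [← hc_of_mem (hd i j), hB, Matrix.smul_apply, Matrix.smul_apply, Matrix.map_apply, smul_eq_mul,
    smul_eq_mul, ← hc_mul (isHomogeneous_X K e)]
  congr 2
  push_cast; ring

/-- exactness at the second spot -/
def E2 (K : Type*) [Field K] (Q : Set (Sym2 (Fin n))) : Prop :=
  ∀ B : Matrix (Fin n) (Fin n) (MvPolynomial (Sym2 (Fin n)) K), B.trace = 0 → Alt (XQ K Q * B) →
    ∃ A, Alt A ∧ B = A * XQ K Q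

/-- exactness at the first spot -/
def E1 (K : Type*) [Field K] (r : Fin n → Fin n → Prop) (Q : Set (Sym2 (Fin n))) : Prop :=
  ∀ M : Matrix (Fin n) (Fin n) (MvPolynomial (Sym2 (Fin n)) K), IsBlk r M →
    ((XQ K Q).adjugate * M).trace = 0 → ∃ B, B.trace = 0 ∧ Alt (M - XQ K Q * B)

lemma trace_mul_XQ_alt {Q : Set (Sym2 (Fin n))} {A : Matrix (Fin n) (Fin n) (MvPolynomial _ K)}
    (hA : Alt A) : (A * XQ K Q).trace = 0 := by
  rw [Matrix.trace_mul_comm]; exact trace_mul_alt (XQ_symm Q) hA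

lemma alt_XAX {Q : Set (Sym2 (Fin n))} {A : Matrix (Fin n) (Fin n) (MvPolynomial _ K)}
    (hA : Alt A) : Alt (XQ K Q * (A * XQ K Q)) := by
  have := hA.conj (XQ K Q)
  rwa [(XQ_symm Q).eq, Matrix.mul_assoc] at this

lemma trace_adj_mul (Y B : Matrix (Fin n) (Fin n) (MvPolynomial (Sym2 (Fin n)) K)) :
    (Y.adjugate * (Y * B)).trace = Y.det * B.trace := by
  rw [← Matrix.mul_assoc, Matrix.adjugate_mul, Matrix.smul_mul, Matrix.one_mul, Matrix.trace_smul,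
    smul_eq_mul]

lemma trace_map_phi (e : Sym2 (Fin n)) (B : Matrix (Fin n) (Fin n) (MvPolynomial (Sym2 (Fin n)) K)) :
    (B.map (phi K e)).trace = phi K e B.trace := by
  simp [Matrix.trace, map_sum]

lemma map_phi_mul (e : Sym2 (Fin n)) (A B : Matrix (Fin n) (Fin n) (MvPolynomial (Sym2 (Fin n)) K)) :
    (A * B).map (phi K e) = A.map (phi K e) * B.map (phi K e) := Matrix.map_mul

lemma E2_del_aux {e : Sym2 (Fin n)} {Q : Set (Sym2 (Fin n))} (he : e ∉ Q) (h : E2 K Q) (N : ℕ) :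
    ∀ d : ℤ, d < N → ∀ B : Matrix (Fin n) (Fin n) (MvPolynomial (Sym2 (Fin n)) K),
      (∀ i j, B i j ∈ gr _ K d) → B.trace = 0 → Alt (XQ K (insert e Q) * B) →
      ∃ A, Alt A ∧ B = A * XQ K (insert e Q) := by
  induction N with
  | zero =>
    intro d hd B hB _ _
    refine ⟨0, Alt.zero, ?_⟩
    ext1 i j
    have := hB i j
    rw [gr_neg (by simpa using hd), Submodule.mem_bot] at this
    simp [this]
  | succ N ih =>
    intro d hd B hB ht hA
    set Y := XQ K (insert e Q) with hY
    have hφY : Y.map (phi K e) = XQ K Q := phi_XQ he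
    obtain ⟨A, hAa, hBA⟩ := h (B.map (phi K e)) (by rw [trace_map_phi, ht, map_zero]) (by
      rw [← hφY, ← map_phi_mul]; exact hA.map _)
    set A1 := (A.map (hc (d - 1))).map (phi K e) with hA1
    have hA1a : Alt A1 := (hAa.map _).map _
    have hA1g : ∀ i j, A1 i j ∈ gr _ K (d - 1) := fun i j => phi_gr _ (hc_mem _ _)
    have hA1φ : A1.map (phi K e) = A1 := by
      ext1 i j; simp only [hA1, Matrix.map_apply, phi_phi]
    have hBA1 : B.map (phi K e) = A1 * XQ K Q := by
      have h1 : (B.map (phi K e)).map (hc d) = B.map (phi K e) := by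
        ext1 i j; exact hc_of_mem (phi_gr _ (hB i j))
      have h2 := hc_matmul' (XQ_hom (K := K) Q) (d - 1) A
      rw [show ((1 : ℕ) : ℤ) + (d - 1) = d by push_cast; ring, ← hBA, h1] at h2
      have h3 := congrArg (fun M => M.map (phi K e)) h2
      simp only [map_phi_mul] at h3
      have h4 : (XQ K Q).map (phi K e) = XQ K Q := by
        rw [← hφY]; ext1 i j; simp only [Matrix.map_apply, phi_phi]
      rw [h4] at h3
      rw [← h3]
      ext1 i j; simp only [Matrix.map_apply, phi_phi]
    have hD : (B - A1 * Y).map (phi K e) = 0 := by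
      have : (B - A1 * Y).map (phi K e) = B.map (phi K e) - (A1 * Y).map (phi K e) := by
        ext1 i j; simp only [Matrix.map_apply, Matrix.sub_apply, map_sub]
      rw [this, map_phi_mul, hφY, hA1φ, hBA1, sub_self]
    have hDg : ∀ i j, (B - A1 * Y) i j ∈ gr _ K d := fun i j => by
      rw [Matrix.sub_apply]
      refine Submodule.sub_mem _ (hB i j) ?_
      rw [Matrix.mul_apply]
      refine Submodule.sum_mem _ fun k _ => ?_
      have := gr_mul (XQ_hom (K := K) (insert e Q) k j) (hA1g i k)
      rw [mul_comm]
      convert this using 2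
      push_cast; ring
    obtain ⟨B', hB', hB'g⟩ := exists_factor_hom hD hDg
    have hX : (X e : MvPolynomial (Sym2 (Fin n)) K) ≠ 0 := X_ne_zero e
    obtain ⟨A', hA', hBA'⟩ := ih (d - 1) (by push_cast at hd; linarith) B' hB'g (by
      have h1 := congrArg Matrix.trace hB'
      rw [Matrix.trace_sub, ht, trace_mul_XQ_alt hA1a, sub_zero, Matrix.trace_smul] at h1
      simpa [hX] using h1.symm) (by
      apply Alt.of_smul hX
      rw [← Matrix.mul_smul, ← hB', Matrix.mul_sub]
      exact hA.sub (alt_XAX hA1a))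
    refine ⟨A1 + (X e : MvPolynomial _ K) • A', hA1a.add (hA'.smul _), ?_⟩
    rw [Matrix.add_mul, Matrix.smul_mul, ← hBA', ← hB']
    abel

lemma E2_del {e : Sym2 (Fin n)} {Q : Set (Sym2 (Fin n))} (he : e ∉ Q) (h : E2 K Q) :
    E2 K (insert e Q) := by
  intro B ht hA
  obtain ⟨N, hN⟩ := exists_bound B
  have h1 : ∀ k : ℕ, ∃ A, Alt A ∧ B.map (hc (k : ℤ)) = A * XQ K (insert e Q) := fun k =>
    E2_del_aux he h (k + 1) k (by push_cast; linarith) (B.map (hc k)) (fun i j => hc_mem _ _)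
      (by rw [trace_hc, ht, map_zero])
      (by rw [← hc_matmul (XQ_hom _)]; exact hA.map _)
  choose A hA1 hA2 using h1
  refine ⟨∑ k ∈ Finset.range N, A k, ?_, ?_⟩
  · exact Finset.sum_induction _ Alt (fun _ _ => Alt.add) Alt.zero fun k _ => hA1 k
  · rw [Finset.sum_mul]
    conv_lhs => rw [hN]
    exact Finset.sum_congr rfl fun k _ => hA2 k

lemma E1_del_aux {r : Fin n → Fin n → Prop} (hr : Equivalence r)
    {e : Sym2 (Fin n)} {Q : Set (Sym2 (Fin n))} (he : e ∉ Q)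
    (hQ : ∀ i j, s(i, j) ∈ insert e Q → r i j) (h : E1 K r Q) (N : ℕ) :
    ∀ d : ℤ, d < N → ∀ M : Matrix (Fin n) (Fin n) (MvPolynomial (Sym2 (Fin n)) K),
      (∀ i j, M i j ∈ gr _ K d) → IsBlk r M → ((XQ K (insert e Q)).adjugate * M).trace = 0 →
      ∃ B, B.trace = 0 ∧ Alt (M - XQ K (insert e Q) * B) := by
  induction N with
  | zero =>
    intro d hd B hB _ _
    refine ⟨0, by simp, ?_⟩
    have : B = 0 := by
      ext1 i j
      have := hB i j
      rw [gr_neg (by simpa using hd), Submodule.mem_bot] at this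
      simp [this]
    rw [this]; simp [Alt.zero]
  | succ N ih =>
    intro d hd M hM hMb ht
    set Y := XQ K (insert e Q) with hY
    have hYb : IsBlk r Y := fun i j hij => by
      rw [hY, XQ_apply, if_neg fun h' => hij (hQ i j h')]
    have hφY : Y.map (phi K e) = XQ K Q := phi_XQ he
    have hX0b : IsBlk r (XQ K Q) := hφY ▸ hYb.map _
    have h4 : (XQ K Q).map (phi K e) = XQ K Q := by
      rw [← hφY]; ext1 i j; simp only [Matrix.map_apply, phi_phi]
    have hMφ : (M.map (phi K e)).map (phi K e) = M.map (phi K e) := by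
      ext1 i j; simp only [Matrix.map_apply, phi_phi]
    obtain ⟨B, hB0, hBA⟩ := h (M.map (phi K e)) (hMb.map _) (by
      have h5 : (XQ K Q).adjugate = Y.adjugate.map (phi K e) := by
        rw [← hφY]; exact ((phi K e).map_adjugate Y).symm
      rw [h5, ← map_phi_mul, trace_map_phi, ht, map_zero])
    set B1 := ((blk r B).map (hc (d - 1))).map (phi K e) with hB1
    have hB1t : B1.trace = 0 := by
      rw [hB1, trace_map_phi, trace_hc, trace_blk hr, hB0, map_zero, map_zero]
    have hB1g : ∀ i j, B1 i j ∈ gr _ K (d - 1) := fun i j => phi_gr _ (hc_mem _ _)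
    have hB1b : IsBlk r B1 := ((blk_isBlk B).map _).map _
    have hB1φ : B1.map (phi K e) = B1 := by
      ext1 i j; simp only [hB1, Matrix.map_apply, phi_phi]
    set A := M.map (phi K e) - XQ K Q * B1 with hA
    have hAalt : Alt A := by
      have h1 := ((hBA.blk hr).map (hc d)).map (phi K e)
      rw [blk_sub, blk_mul hr hX0b, (hMb.map (phi K e)).blk_eq] at h1
      have h2 : ((M.map (phi K e) - XQ K Q * blk r B).map (hc d)).map (phi K e) = A := by
        have e1 : (M.map (phi K e) - XQ K Q * blk r B).map (hc d)
            = (M.map (phi K e)).map (hc d) - (XQ K Q * blk r B).map (hc d) := by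
          ext1 i j; simp
        have e2 : (M.map (phi K e)).map (hc d) = M.map (phi K e) := by
          ext1 i j; exact hc_of_mem (phi_gr _ (hM i j))
        have e3 := hc_matmul (XQ_hom (K := K) Q) (d - 1) (blk r B)
        rw [show ((1 : ℕ) : ℤ) + (d - 1) = d by push_cast; ring] at e3
        rw [e1, e2, e3]
        have e4 : (M.map (phi K e) - XQ K Q * (blk r B).map (hc (d - 1))).map (phi K e)
            = (M.map (phi K e)).map (phi K e)
              - (XQ K Q * (blk r B).map (hc (d - 1))).map (phi K e) := by
          ext1 i j; simp only [Matrix.map_apply, Matrix.sub_apply, map_sub]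
        rw [e4, map_phi_mul, h4, hMφ]
      rw [h2] at h1; exact h1
    have hD : (M - Y * B1 - A).map (phi K e) = 0 := by
      have : (M - Y * B1 - A).map (phi K e)
          = M.map (phi K e) - (Y * B1).map (phi K e) - ((M.map (phi K e)).map (phi K e)
            - (XQ K Q * B1).map (phi K e)) := by
        ext1 i j; simp only [hA, Matrix.map_apply, Matrix.sub_apply, map_sub]
      rw [this, map_phi_mul, map_phi_mul, hφY, hB1φ, h4, hMφ, sub_self]
    have hmulg : ∀ Q' : Set (Sym2 (Fin n)), ∀ i j, (XQ K Q' * B1) i j ∈ gr _ K d := fun Q' i j => by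
      rw [Matrix.mul_apply]
      refine Submodule.sum_mem _ fun k _ => ?_
      have := gr_mul (XQ_hom (K := K) Q' i k) (hB1g k j)
      convert this using 2
      push_cast; ring
    have hDg : ∀ i j, (M - Y * B1 - A) i j ∈ gr _ K d := fun i j => by
      rw [Matrix.sub_apply, Matrix.sub_apply]
      refine Submodule.sub_mem _ (Submodule.sub_mem _ (hM i j) (hmulg _ i j)) ?_
      rw [hA, Matrix.sub_apply]
      exact Submodule.sub_mem _ (phi_gr _ (hM i j)) (hmulg _ i j)
    obtain ⟨M', hM', hM'g⟩ := exists_factor_hom hD hDg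
    have hDb : IsBlk r (M - Y * B1 - A) :=
      (hMb.sub (hYb.mul hr hB1b)).sub ((hMb.map _).sub (hX0b.mul hr hB1b))
    have hX : (X e : MvPolynomial (Sym2 (Fin n)) K) ≠ 0 := X_ne_zero e
    obtain ⟨B', hB't, hB'a⟩ := ih (d - 1) (by push_cast at hd; linarith) M' hM'g (by
      intro i j hij
      have h1 := hDb i j hij
      rw [hM', Matrix.smul_apply, smul_eq_mul] at h1
      exact (mul_eq_zero.1 h1).resolve_left hX) (by
      have h1 : (Y.adjugate * (M - Y * B1 - A)).trace = 0 := by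
        rw [Matrix.mul_sub, Matrix.mul_sub, Matrix.trace_sub, Matrix.trace_sub, ht, trace_adj_mul,
          hB1t, trace_mul_alt (XQ_symm _).adjugate hAalt]
        simp
      rw [hM', Matrix.mul_smul, Matrix.trace_smul, smul_eq_mul] at h1
      exact (mul_eq_zero.1 h1).resolve_left hX)
    refine ⟨B1 + (X e : MvPolynomial _ K) • B', by
      rw [Matrix.trace_add, Matrix.trace_smul, hB1t, hB't]; simp, ?_⟩
    have : M - Y * (B1 + (X e : MvPolynomial _ K) • B')
        = A + (X e : MvPolynomial _ K) • (M' - Y * B') := by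
      rw [smul_sub, ← hM', Matrix.mul_add, Matrix.mul_smul]; abel
    rw [this]
    exact hAalt.add (hB'a.smul _)

lemma E1_del {r : Fin n → Fin n → Prop} (hr : Equivalence r)
    {e : Sym2 (Fin n)} {Q : Set (Sym2 (Fin n))} (he : e ∉ Q)
    (hQ : ∀ i j, s(i, j) ∈ insert e Q → r i j) (h : E1 K r Q) : E1 K r (insert e Q) := by
  intro M hMb ht
  obtain ⟨N, hN⟩ := exists_bound M
  have h1 : ∀ k : ℕ, ∃ B, B.trace = 0 ∧ Alt (M.map (hc (k : ℤ)) - XQ K (insert e Q) * B) := fun k =>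
    E1_del_aux hr he hQ h (k + 1) k (by push_cast; linarith) (M.map (hc k)) (fun i j => hc_mem _ _)
      (hMb.map _)
      (by rw [← hc_matmul (adj_hom (XQ_hom _)), trace_hc, ht, map_zero])
  choose B hB1 hB2 using h1
  refine ⟨∑ k ∈ Finset.range N, B k, ?_, ?_⟩
  · rw [Matrix.trace_sum]; exact Finset.sum_eq_zero fun k _ => hB1 k
  · have : M - XQ K (insert e Q) * ∑ k ∈ Finset.range N, B k
        = ∑ k ∈ Finset.range N, (M.map (hc (k : ℤ)) - XQ K (insert e Q) * B k) := by
      rw [Finset.sum_sub_distrib, ← hN, Finset.mul_sum]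
    rw [this]
    exact Finset.sum_induction _ Alt (fun _ _ => Alt.add) Alt.zero fun k _ => hB2 k

end del
end SMin


namespace SMin

section base
variable {n : ℕ} {K : Type*} [Field K]

lemma X_dvd_of_mul {σ : Type*} {e f : σ} (h : e ≠ f) {p : MvPolynomial σ K}
    (hp : (X e : MvPolynomial σ K) ∣ X f * p) : (X e : MvPolynomial σ K) ∣ p := by
  rcases (X_prime (R := K) (i := e)).dvd_or_dvd hp with h1 | h1
  · exact absurd ((X_dvd_X).1 h1) h
  · exact h1

lemma alt_right {Q : Set (Sym2 (Fin n))} (hd : (XQ K Q).det ≠ 0)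
    {A B : Matrix (Fin n) (Fin n) (MvPolynomial (Sym2 (Fin n)) K)}
    (hB : Alt (XQ K Q * B)) (h : B = A * XQ K Q) : Alt A := by
  apply alt_of_conj (XQ_symm (K := K) Q) hd
  rwa [Matrix.mul_assoc, ← h]

/-- the set of diagonal pairs -/
def dg (n : ℕ) : Set (Sym2 (Fin n)) := {e | e.IsDiag}

lemma mem_dg (i j : Fin n) : s(i, j) ∈ dg n ↔ i = j := by simp [dg]

lemma XQ_dg : XQ K (dg n) = Matrix.diagonal fun i => (X s(i, i) : MvPolynomial (Sym2 (Fin n)) K) := by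
  ext1 i j
  rw [XQ_apply, Matrix.diagonal_apply]
  simp only [mem_dg]
  split_ifs with h
  · rw [h]
  · rfl

lemma diag_inj {i j : Fin n} (h : i ≠ j) : (s(i, i) : Sym2 (Fin n)) ≠ s(j, j) := by
  simp [h]

lemma det_dg : (XQ K (dg n)).det ≠ 0 := by
  rw [XQ_dg, Matrix.det_diagonal]
  exact Finset.prod_ne_zero_iff.2 fun i _ => X_ne_zero _

lemma E2_dg : E2 K (dg n) := by
  intro B _ hA
  have h1 : ∀ i j, (XQ K (dg n) * B) i j = X s(i, i) * B i j := fun i j => by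
    rw [XQ_dg, Matrix.diagonal_mul]
  have h2 : ∀ i j, ∃ a, B i j = a * X s(j, j) := fun i j => by
    by_cases hij : i = j
    · subst hij
      have := hA.1 i
      rw [h1] at this
      exact ⟨0, by rw [zero_mul]; exact (mul_eq_zero.1 this).resolve_left (X_ne_zero _)⟩
    · have := hA.2 i j
      rw [h1, h1] at this
      have h3 : (X s(j, j) : MvPolynomial (Sym2 (Fin n)) K) ∣ X s(i, i) * B i j :=
        ⟨- B j i, by rw [this]; ring⟩
      obtain ⟨a, ha⟩ := X_dvd_of_mul (diag_inj (Ne.symm hij)) h3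
      exact ⟨a, by rw [ha, mul_comm]⟩
  choose A hA' using h2
  have h3 : B = Matrix.of A * XQ K (dg n) := by
    ext1 i j
    rw [XQ_dg, Matrix.mul_diagonal, Matrix.of_apply, hA']
  exact ⟨_, alt_right det_dg hA h3, h3⟩

/-- special base set -/
def Q0 (u v : Fin n) : Set (Sym2 (Fin n)) := {e | (∃ i, i ≠ v ∧ e = s(i, i)) ∨ e = s(u, v)}

lemma mem_Q0 {u v : Fin n} (i j : Fin n) :
    s(i, j) ∈ Q0 u v ↔ (i = j ∧ i ≠ v) ∨ (i = u ∧ j = v) ∨ (i = v ∧ j = u) := by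
  simp only [Q0, Set.mem_ofPred_eq, Sym2.eq_iff]
  constructor
  · rintro (⟨k, hk, h | h⟩ | h)
    · left; exact ⟨h.1.trans h.2.symm, h.1 ▸ hk⟩
    · left; exact ⟨h.1.trans h.2.symm, h.1 ▸ hk⟩
    · right; exact h
  · rintro (h | h)
    · left; exact ⟨i, h.2, by simp [h.1]⟩
    · right; exact h

section
variable {u v : Fin n} (w : Fin n → MvPolynomial (Sym2 (Fin n)) K)

lemma row_v (huv : u ≠ v) : ∑ k, XQ K (Q0 u v) v k * w k = X s(u, v) * w u := by
  rw [Finset.sum_eq_single u]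
  · rw [XQ_apply, if_pos ((mem_Q0 _ _).2 (by simp)), Sym2.eq_swap]
  · intro k _ hk
    rw [XQ_apply, if_neg (by rw [mem_Q0]; simp [hk, huv.symm]), zero_mul]
  · simp

lemma row_u (huv : u ≠ v) : ∑ k, XQ K (Q0 u v) u k * w k = X s(u, v) * w v + X s(u, u) * w u := by
  rw [Fintype.sum_eq_add v u huv.symm]
  · rw [XQ_apply, XQ_apply, if_pos ((mem_Q0 _ _).2 (by simp)),
      if_pos ((mem_Q0 _ _).2 (by simp [huv]))]
  · intro k hk
    rw [XQ_apply, if_neg (by rw [mem_Q0]; simp [hk.1, hk.2.symm, huv]), zero_mul]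

lemma row_j {j : Fin n} (hu : j ≠ u) (hv : j ≠ v) :
    ∑ k, XQ K (Q0 u v) j k * w k = X s(j, j) * w j := by
  rw [Finset.sum_eq_single j]
  · rw [XQ_apply, if_pos ((mem_Q0 _ _).2 (by simp [hv]))]
  · intro k _ hk
    rw [XQ_apply, if_neg (by rw [mem_Q0]; simp [hk.symm, hu, hv]), zero_mul]
  · simp

lemma det_Q0 (huv : u ≠ v) : (XQ K (Q0 u v)).det ≠ 0 := by
  intro h0
  obtain ⟨w, hw, h⟩ := Matrix.exists_mulVec_eq_zero_iff.2 h0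
  apply hw
  have hx : (X s(u, v) : MvPolynomial (Sym2 (Fin n)) K) ≠ 0 := X_ne_zero _
  have h' : ∀ i, ∑ k, XQ K (Q0 u v) i k * w k = 0 := fun i => congrFun h i
  have h1 : w u = 0 := by
    have := h' v
    rw [row_v _ huv] at this
    exact (mul_eq_zero.1 this).resolve_left hx
  have h2 : w v = 0 := by
    have := h' u
    rw [row_u _ huv, h1, mul_zero, add_zero] at this
    exact (mul_eq_zero.1 this).resolve_left hx
  ext1 j
  by_cases hu : j = u
  · rw [hu, h1]; rfl
  by_cases hv : j = v
  · rw [hv, h2]; rfl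
  have := h' j
  rw [row_j _ hu hv] at this
  exact (mul_eq_zero.1 this).resolve_left (X_ne_zero _)

lemma E2_Q0 (huv : u ≠ v) : E2 K (Q0 u v) := by
  intro B _ hA
  set x : MvPolynomial (Sym2 (Fin n)) K := X s(u, v) with hxdef
  set b : MvPolynomial (Sym2 (Fin n)) K := X s(u, u) with hbdef
  have hx : x ≠ 0 := X_ne_zero _
  have rv : ∀ j, (XQ K (Q0 u v) * B) v j = x * B u j := fun j => by
    rw [Matrix.mul_apply]; exact row_v (huv := huv) (w := fun k => B k j)
  have ru : ∀ j, (XQ K (Q0 u v) * B) u j = x * B v j + b * B u j := fun j => by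
    rw [Matrix.mul_apply]; exact row_u (huv := huv) (w := fun k => B k j)
  have rj : ∀ i j, i ≠ u → i ≠ v → (XQ K (Q0 u v) * B) i j = X s(i, i) * B i j :=
    fun i j h1 h2 => by
      rw [Matrix.mul_apply]; exact row_j (fun k => B k j) h1 h2
  have hxb : (s(u, v) : Sym2 (Fin n)) ≠ s(u, u) := by simp [huv.symm]
  have hxc : ∀ j : Fin n, (s(u, v) : Sym2 (Fin n)) ≠ s(j, j) := fun j h => by
    rw [Sym2.eq_iff] at h
    rcases h with h | h <;> exact huv (h.1.trans h.2.symm)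
  have fuv : B u v = 0 := by
    have := hA.1 v; rw [rv] at this; exact (mul_eq_zero.1 this).resolve_left hx
  have fuu : x * B v u + b * B u u = 0 := by
    have := hA.1 u; rwa [ru] at this
  have fvv : B v v = - B u u := by
    have := hA.2 v u; rw [rv, ru, fuv] at this
    apply mul_left_cancel₀ hx
    linear_combination this
  have fjj : ∀ j, j ≠ u → j ≠ v → B j j = 0 := fun j h1 h2 => by
    have := hA.1 j; rw [rj _ _ h1 h2] at this
    exact (mul_eq_zero.1 this).resolve_left (X_ne_zero _)
  have fvj : ∀ j, j ≠ u → j ≠ v → x * B u j = - (X s(j, j) * B j v) := fun j h1 h2 => by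
    have := hA.2 v j; rwa [rv, rj _ _ h1 h2] at this
  have fuj : ∀ j, j ≠ u → j ≠ v → x * B v j + b * B u j = - (X s(j, j) * B j u) :=
    fun j h1 h2 => by
      have := hA.2 u j; rwa [ru, rj _ _ h1 h2] at this
  have fij : ∀ i j, i ≠ u → i ≠ v → j ≠ u → j ≠ v → X s(i, i) * B i j = - (X s(j, j) * B j i) :=
    fun i j h1 h2 h3 h4 => by
      have := hA.2 i j; rwa [rj _ _ h1 h2, rj _ _ h3 h4] at this
  have dc : ∀ i j, j ≠ u → j ≠ v → ∃ a, B i j = a * X s(j, j) := fun i j h1 h2 => by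
    suffices (X s(j, j) : MvPolynomial (Sym2 (Fin n)) K) ∣ B i j by
      obtain ⟨a, ha⟩ := this; exact ⟨a, by rw [ha, mul_comm]⟩
    have du : (X s(j, j) : MvPolynomial (Sym2 (Fin n)) K) ∣ B u j :=
      X_dvd_of_mul (hxc j).symm ⟨- B j v, by rw [← hxdef, fvj j h1 h2]; ring⟩
    by_cases hu : i = u
    · rw [hu]; exact du
    by_cases hv : i = v
    · rw [hv]
      obtain ⟨a, ha⟩ := du
      exact X_dvd_of_mul (hxc j).symm ⟨- B j u - b * a, by
        have := fuj j h1 h2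
        rw [ha] at this
        linear_combination this⟩
    by_cases hij : i = j
    · rw [hij, fjj j h1 h2]; exact dvd_zero _
    · exact X_dvd_of_mul (diag_inj (Ne.symm hij)) ⟨- B j i, by rw [fij i j hu hv h1 h2]; ring⟩
  have dxu : x ∣ B u u := X_dvd_of_mul hxb ⟨- B v u, by linear_combination fuu⟩
  have dx : ∀ i, ∃ a, B i v = a * x := fun i => by
    suffices x ∣ B i v by
      obtain ⟨a, ha⟩ := this; exact ⟨a, by rw [ha, mul_comm]⟩
    by_cases hu : i = u
    · rw [hu, fuv]; exact dvd_zero _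
    by_cases hv : i = v
    · rw [hv, fvv]; exact dxu.neg_right
    · exact X_dvd_of_mul (hxc i) ⟨- B u i, by linear_combination (fvj i hu hv)⟩
  choose Au hAu using dx
  have dx2 : ∀ i, ∃ a, B i u = a * x + Au i * b := fun i => by
    suffices x ∣ B i u - Au i * b by
      obtain ⟨a, ha⟩ := this; exact ⟨a, by linear_combination ha⟩
    by_cases hu : i = u
    · rw [hu]
      have : Au u = 0 := by
        have h1 := hAu u
        rw [fuv] at h1
        exact (mul_eq_zero.1 h1.symm).resolve_right hx
      rw [this, zero_mul, sub_zero]; exact dxu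
    by_cases hv : i = v
    · rw [hv]
      have : B v u - Au v * b = 0 := by
        apply mul_left_cancel₀ hx
        have h1 := hAu v
        linear_combination fuu + b * h1 - b * fvv
      rw [this]; exact dvd_zero _
    · have h2 : B u i = - (X s(i, i) * Au i) := by
        apply mul_left_cancel₀ hx
        have h1 := fvj i hu hv
        rw [hAu] at h1
        linear_combination h1
      refine X_dvd_of_mul (hxc i) ⟨- B v i, ?_⟩
      have h1 := fuj i hu hv
      rw [h2] at h1
      linear_combination h1
  choose Av hAv using dx2
  choose Aj hAj using dc
  set A : Matrix (Fin n) (Fin n) (MvPolynomial (Sym2 (Fin n)) K) := Matrix.of fun i j =>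
    if h1 : j = u then Au i else if h2 : j = v then Av i else Aj i j h1 h2 with hAdef
  have h3 : B = A * XQ K (Q0 u v) := by
    ext1 i j
    have e1 : (A * XQ K (Q0 u v)) i j = ∑ k, XQ K (Q0 u v) j k * A i k := by
      rw [Matrix.mul_apply]
      refine Finset.sum_congr rfl fun k _ => ?_
      rw [mul_comm, (XQ_symm (K := K) (Q0 u v)).apply]
    have eAu : A i u = Au i := by simp [hAdef]
    have eAv : A i v = Av i := by simp [hAdef, huv.symm]
    rw [e1]
    by_cases hu : j = u
    · subst hu
      rw [row_u _ huv, eAu, eAv, hAv]; ring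
    by_cases hv : j = v
    · subst hv
      rw [row_v _ huv, eAu, hAu]; ring
    · rw [row_j _ hu hv, hAj i j hu hv]
      simp [hAdef, hu, hv]; ring
  exact ⟨A, alt_right (det_Q0 huv) hA h3, h3⟩
end

lemma E2_mono {Q Q' : Set (Sym2 (Fin n))} (h : Q ⊆ Q') (hQ : E2 K Q) : E2 K Q' := by
  have key : ∀ S : Finset (Sym2 (Fin n)), E2 K (Q ∪ (S : Set (Sym2 (Fin n)))) := fun S => by
    induction S using Finset.induction_on with
    | empty => simpa using hQ
    | insert e S _ ih =>
      rw [Finset.coe_insert, Set.union_insert]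
      by_cases he : e ∈ Q ∪ (S : Set (Sym2 (Fin n)))
      · rwa [Set.insert_eq_of_mem he]
      · exact E2_del he ih
  have := key Q'.toFinset
  rwa [Set.coe_toFinset, Set.union_eq_self_of_subset_left h] at this

lemma E1_mono {r : Fin n → Fin n → Prop} (hr : Equivalence r) {Q Q' : Set (Sym2 (Fin n))}
    (h : Q ⊆ Q') (hQ' : ∀ i j, s(i, j) ∈ Q' → r i j) (hQ : E1 K r Q) : E1 K r Q' := by
  have key : ∀ S : Finset (Sym2 (Fin n)), (S : Set (Sym2 (Fin n))) ⊆ Q' →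
      E1 K r (Q ∪ (S : Set (Sym2 (Fin n)))) := fun S => by
    induction S using Finset.induction_on with
    | empty => intro _; simpa using hQ
    | insert e S _ ih =>
      intro hS
      rw [Finset.coe_insert, Set.insert_subset_iff] at hS
      rw [Finset.coe_insert, Set.union_insert]
      by_cases he : e ∈ Q ∪ (S : Set (Sym2 (Fin n)))
      · rw [Set.insert_eq_of_mem he]; exact ih hS.2
      · refine E1_del hr he (fun i j hij => hQ' i j ?_) (ih hS.2)
        rcases Set.mem_insert_iff.1 hij with h1 | h1 | h1
        · rw [h1]; exact hS.1
        · exact h h1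
        · exact hS.2 h1
  have := key Q'.toFinset (by simp)
  rwa [Set.coe_toFinset, Set.union_eq_self_of_subset_left h] at this

lemma E1_dg : E1 K (· = ·) (dg n) := by
  intro M hM ht
  have hM' : M = Matrix.diagonal fun i => M i i := by
    ext1 i j
    rw [Matrix.diagonal_apply]
    split_ifs with h
    · rw [h]
    · exact hM i j h
  rw [XQ_dg, Matrix.adjugate_diagonal, hM', Matrix.diagonal_mul_diagonal,
    Matrix.trace_diagonal] at ht
  have h1 : ∀ i, ∃ c, M i i = X s(i, i) * c := fun i => by
    have h2 : (X s(i, i) : MvPolynomial (Sym2 (Fin n)) K) ∣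
        (∏ j ∈ Finset.univ.erase i, X s(j, j)) * M i i := by
      rw [← Finset.add_sum_erase _ _ (Finset.mem_univ i)] at ht
      have h3 := eq_neg_of_add_eq_zero_left ht
      rw [h3]
      apply dvd_neg.2
      apply Finset.dvd_sum
      intro j hj
      apply dvd_mul_of_dvd_left
      exact Finset.dvd_prod_of_mem (fun k => (X s(k, k) : MvPolynomial (Sym2 (Fin n)) K))
        (Finset.mem_erase.2 ⟨(Finset.ne_of_mem_erase hj).symm, Finset.mem_univ i⟩)
    rcases (X_prime (R := K) (i := (s(i, i) : Sym2 (Fin n)))).dvd_or_dvd h2 with h4 | h4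
    · obtain ⟨j, hj, hj2⟩ := (X_prime.dvd_finsetProd_iff _).1 h4
      exact absurd (X_dvd_X.1 hj2) (diag_inj (Finset.ne_of_mem_erase hj).symm)
    · exact h4
  choose c hc using h1
  refine ⟨Matrix.diagonal c, ?_, ?_⟩
  · rw [Matrix.trace_diagonal]
    have h2 : (∏ j, (X s(j, j) : MvPolynomial (Sym2 (Fin n)) K)) * ∑ i, c i = 0 := by
      rw [← ht, Finset.mul_sum]
      refine Finset.sum_congr rfl fun i _ => ?_
      rw [hc, ← Finset.mul_prod_erase _ _ (Finset.mem_univ i)]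
      ring
    exact (mul_eq_zero.1 h2).resolve_left (Finset.prod_ne_zero_iff.2 fun i _ => X_ne_zero _)
  · have : M - XQ K (dg n) * Matrix.diagonal c = 0 := by
      rw [hM', XQ_dg, Matrix.diagonal_mul_diagonal]
      ext1 i j
      simp only [Matrix.sub_apply, Matrix.diagonal_apply, Matrix.zero_apply, hc]
      split_ifs <;> simp [*]
    rw [this]; exact Alt.zero

end base
end SMin


namespace SMin

section pend
variable {n : ℕ} {K : Type*} [Field K]

lemma det_XQ {Q : Set (Sym2 (Fin n))} (h : dg n ⊆ Q) : (XQ K Q).det ≠ 0 := by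
  intro h0
  have h1 := congrArg (aeval fun e : Sym2 (Fin n) => if e.IsDiag then (1 : K) else 0) h0
  rw [map_zero, AlgHom.map_det] at h1
  have h2 : (aeval fun e : Sym2 (Fin n) => if e.IsDiag then (1 : K) else 0).mapMatrix (XQ K Q)
      = 1 := by
    ext1 i j
    rw [AlgHom.mapMatrix_apply, Matrix.map_apply, XQ_apply, Matrix.one_apply]
    by_cases hij : i = j
    · rw [if_pos (h ((mem_dg i j).2 hij))]
      simp [hij]
    · rw [if_neg hij]
      split_ifs <;> simp [hij]
  rw [h2, Matrix.det_one] at h1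
  exact one_ne_zero h1

/-- torsion statement -/
lemma torsion {v : Fin n} {r r' : Fin n → Fin n → Prop} (hr' : Equivalence r')
    {Q' : Set (Sym2 (Fin n))} (hdg : dg n ⊆ Q') (hv : ∀ j, s(v, j) ∈ Q' → j = v)
    (hrr : ∀ i j, i ≠ v → j ≠ v → r i j → r' i j)
    (hblk : ∀ i j, s(i, j) ∈ Q' → r' i j) (hE : E1 K r' Q')
    {M : Matrix (Fin n) (Fin n) (MvPolynomial (Sym2 (Fin n)) K)} (hM : IsBlk r M)
    (ht : ((XQ K Q').adjugate * M).trace = 0) :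
    ∃ B, B.trace = 0 ∧ Alt ((X s(v, v) : MvPolynomial (Sym2 (Fin n)) K) • M - XQ K Q' * B) := by
  have hXb : IsBlk r' (XQ K Q') := fun i j hij => by
    rw [XQ_apply, if_neg fun h' => hij (hblk i j h')]
  have hab := adjugate_isBlk hr' hXb (det_XQ hdg)
  obtain ⟨B', hB't, hB'a⟩ := hE (blk r' M) (blk_isBlk M) (by
    rw [← blk_mul hr' hab, trace_blk hr', ht])
  set Mo := M - blk r' M with hMo
  have hMo0 : ∀ i j, r' i j → Mo i j = 0 := fun i j h => by
    rw [hMo, Matrix.sub_apply]; simp [blk, h]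
  have hMo1 : ∀ i j, i ≠ v → j ≠ v → Mo i j = 0 := fun i j hi hj => by
    by_cases h : r' i j
    · exact hMo0 i j h
    · rw [hMo, Matrix.sub_apply, blk_isBlk M i j h, hM i j fun h' => h (hrr i j hi hj h'), sub_zero]
  set Bo : Matrix (Fin n) (Fin n) (MvPolynomial (Sym2 (Fin n)) K) := Matrix.of fun i j =>
    if i = v then (if j = v then 0 else Mo v j + Mo j v) else 0 with hBo
  have hXBo : ∀ i j, (XQ K Q' * Bo) i j = if i = v then X s(v, v) * Bo v j else 0 := fun i j => by
    rw [Matrix.mul_apply, Finset.sum_eq_single v]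
    · split_ifs with h
      · rw [h, XQ_apply, if_pos (hdg ((mem_dg v v).2 rfl))]
      · rw [XQ_apply, if_neg, zero_mul]
        intro h'
        rw [Sym2.eq_swap] at h'
        exact h (hv i h')
    · intro k _ hk
      simp [hBo, hk]
    · simp
  have hAo : Alt ((X s(v, v) : MvPolynomial (Sym2 (Fin n)) K) • Mo - XQ K Q' * Bo) := by
    have e : ∀ i j, ((X s(v, v) : MvPolynomial (Sym2 (Fin n)) K) • Mo - XQ K Q' * Bo) i j
        = X s(v, v) * Mo i j - if i = v then X s(v, v) * Bo v j else 0 := fun i j => by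
      rw [Matrix.sub_apply, Matrix.smul_apply, hXBo, smul_eq_mul]
    constructor
    · intro i
      rw [e, hMo0 i i (hr'.refl i)]
      split_ifs with h
      · simp [hBo, h]
      · simp
    · intro i j
      rw [e, e]
      by_cases hi : i = v
      · subst hi
        by_cases hj : j = i
        · subst hj; rw [hMo0 j j (hr'.refl j)]; simp [hBo]
        · simp [hBo, hj]; ring
      · by_cases hj : j = v
        · subst hj; simp [hBo, hi]; ring
        · simp [hi, hj, hMo1]
  refine ⟨(X s(v, v) : MvPolynomial (Sym2 (Fin n)) K) • B' + Bo, ?_, ?_⟩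
  · rw [Matrix.trace_add, Matrix.trace_smul, hB't, smul_zero, zero_add, Matrix.trace]
    refine Finset.sum_eq_zero fun i _ => ?_
    simp only [Matrix.diag_apply, hBo, Matrix.of_apply]
    split_ifs <;> rfl
  · have : (X s(v, v) : MvPolynomial (Sym2 (Fin n)) K) • M
        - XQ K Q' * ((X s(v, v) : MvPolynomial (Sym2 (Fin n)) K) • B' + Bo)
        = (X s(v, v) : MvPolynomial (Sym2 (Fin n)) K) • (blk r' M - XQ K Q' * B')
          + ((X s(v, v) : MvPolynomial (Sym2 (Fin n)) K) • Mo - XQ K Q' * Bo) := by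
      rw [hMo, smul_sub, smul_sub, Matrix.mul_add, Matrix.mul_smul]; abel
    rw [this]
    exact (hB'a.smul _).add hAo

/-- descent -/
lemma descent {v : Fin n} {Q : Set (Sym2 (Fin n))} (hvQ : s(v, v) ∉ Q)
    (hE : E2 K Q) (M : Matrix (Fin n) (Fin n) (MvPolynomial (Sym2 (Fin n)) K)) (k : ℕ) :
    ∀ B, B.trace = 0 →
      Alt ((X s(v, v) : MvPolynomial (Sym2 (Fin n)) K) ^ k • M - XQ K (insert s(v, v) Q) * B) →
      ∃ B, B.trace = 0 ∧ Alt (M - XQ K (insert s(v, v) Q) * B) := by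
  induction k with
  | zero =>
    intro B hB h
    exact ⟨B, hB, by simpa using h⟩
  | succ k ih =>
    intro B hB h
    set a : MvPolynomial (Sym2 (Fin n)) K := X s(v, v) with ha
    set φ := phi K (s(v, v) : Sym2 (Fin n)) with hφ
    set Y := XQ K (insert s(v, v) Q) with hY
    have hφY : Y.map φ = XQ K Q := phi_XQ hvQ
    have h1 : Alt (XQ K Q * B.map φ) := by
      have h2 := Alt.zero.sub (h.map φ)
      have h3 : 0 - (a ^ (k + 1) • M - Y * B).map φ = XQ K Q * B.map φ := by
        rw [← hφY, ← map_phi_mul]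
        ext1 i j
        simp only [Matrix.sub_apply, Matrix.map_apply, map_sub, Matrix.smul_apply, smul_eq_mul,
          map_mul, map_pow, Matrix.zero_apply]
        have : φ a = 0 := by rw [ha, hφ, phi_X, if_pos rfl]
        rw [this, zero_pow (Nat.succ_ne_zero k), zero_mul, zero_sub, zero_sub, neg_neg]
      rwa [h3] at h2
    obtain ⟨A, hA, hBA⟩ := hE (B.map φ) (by rw [trace_map_phi, hB, map_zero]) h1
    have h5 : (XQ K Q).map φ = XQ K Q := by
      rw [← hφY]; ext1 i j; simp only [Matrix.map_apply, hφ, phi_phi]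
    have h4 : B.map φ = A.map φ * XQ K Q := by
      have := congrArg (fun N => N.map φ) hBA
      rw [map_phi_mul, h5] at this
      rw [← this]
      ext1 i j; simp only [Matrix.map_apply, hφ, phi_phi]
    obtain ⟨B2, hB2⟩ := exists_factor (D := B - A.map φ * Y) (e := s(v, v)) (by
      have : (B - A.map φ * Y).map φ = B.map φ - (A.map φ * Y).map φ := by
        ext1 i j; simp only [Matrix.map_apply, Matrix.sub_apply, map_sub]
      rw [← hφ, this, map_phi_mul, hφY, h4]
      have : (A.map φ).map φ = A.map φ := by
        ext1 i j; simp only [Matrix.map_apply, hφ, phi_phi]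
      rw [this, sub_self])
    have ha0 : a ≠ 0 := X_ne_zero _
    apply ih B2
    · have h6 := congrArg Matrix.trace hB2
      rw [Matrix.trace_sub, hB, trace_mul_XQ_alt (hA.map φ), sub_zero, Matrix.trace_smul] at h6
      exact (mul_eq_zero.1 h6.symm).resolve_left ha0
    · apply Alt.of_smul ha0
      have : a • (a ^ k • M - Y * B2) = (a ^ (k + 1) • M - Y * B) + Y * (A.map φ * Y) := by
        rw [smul_sub, ← Matrix.mul_smul, ← hB2, Matrix.mul_sub, smul_smul, ← pow_succ']
        abel
      rw [this]
      exact h.add (alt_XAX (hA.map φ))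

/-- the substitution -/
noncomputable def tau (K : Type*) [Field K] (u v : Fin n) :
    MvPolynomial (Sym2 (Fin n)) K →ₐ[K] MvPolynomial (Sym2 (Fin n)) K :=
  aeval fun e => if e = s(u, v) then X s(v, v) * X s(u, v) else
    if e = s(u, u) then X s(u, u) + X s(v, v) * X s(u, v) ^ 2 else X e

lemma tau_X (u v : Fin n) (e : Sym2 (Fin n)) : tau K u v (X e) =
    if e = s(u, v) then X s(v, v) * X s(u, v) else
    if e = s(u, u) then X s(u, u) + X s(v, v) * X s(u, v) ^ 2 else X e := by
  rw [tau, aeval_X]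

section
variable {u v : Fin n}

lemma tau_a (huv : u ≠ v) : tau K u v (X s(v, v)) = X s(v, v) := by
  rw [tau_X, if_neg, if_neg] <;> simp [huv.symm]

lemma tau_x : tau K u v (X s(u, v)) = X s(v, v) * X s(u, v) := by
  rw [tau_X, if_pos rfl]

lemma tau_b (huv : u ≠ v) : tau K u v (X s(u, u)) = X s(u, u) + X s(v, v) * X s(u, v) ^ 2 := by
  rw [tau_X, if_neg, if_pos rfl]
  simp [huv]

lemma fld1 {F : Type*} [Field F] (a x : F) (ha : a ≠ 0) : a * (x / a) = x := by
  field_simp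

lemma fld2 {F : Type*} [Field F] (a x b : F) (ha : a ≠ 0) :
    b - x ^ 2 / a + a * (x / a) ^ 2 = b := by
  field_simp; ring

lemma conj_calc {R : Type*} [CommRing R] {P P' X1 N B : Matrix (Fin n) (Fin n) R} (a : R)
    (hPP' : P * P' = 1) (hP'P : P' * P = 1) (hPP't : P.transpose * P'.transpose = 1) :
    P.transpose * (a • (P'.transpose * N * P') - X1 * B) * P
      = a • N - P.transpose * X1 * P * (P' * B * P) := by
  rw [Matrix.mul_sub, Matrix.sub_mul, Matrix.mul_smul, Matrix.smul_mul]
  have e1 : P.transpose * (P'.transpose * N * P') * P = N := by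
    calc P.transpose * (P'.transpose * N * P') * P
        = (P.transpose * P'.transpose) * N * (P' * P) := by simp only [Matrix.mul_assoc]
      _ = _ := by rw [hPP't, hP'P, Matrix.one_mul, Matrix.mul_one]
  have e2 : P.transpose * (X1 * B) * P = P.transpose * X1 * P * (P' * B * P) := by
    calc P.transpose * (X1 * B) * P
        = P.transpose * X1 * 1 * (B * P) := by simp only [Matrix.mul_assoc, Matrix.one_mul]
      _ = P.transpose * X1 * (P * P') * (B * P) := by rw [hPP']
      _ = _ := by simp only [Matrix.mul_assoc]
  rw [e1, e2]

lemma tau_inj (huv : u ≠ v) : Function.Injective (tau K u v) := by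
  set S := MvPolynomial (Sym2 (Fin n)) K
  set F := FractionRing S
  set ι : S →ₐ[K] F := IsScalarTower.toAlgHom K S F
  have hι : Function.Injective ι := IsFractionRing.injective S F
  have ha : ι (X s(v, v)) ≠ 0 := fun h => X_ne_zero (R := K) (s(v, v) : Sym2 (Fin n))
    (hι (by rw [h, map_zero]))
  set ψ : S →ₐ[K] F := aeval fun e => if e = s(u, v) then ι (X s(u, v)) / ι (X s(v, v)) else
    if e = s(u, u) then ι (X s(u, u)) - ι (X s(u, v)) ^ 2 / ι (X s(v, v)) else ι (X e) with hψ
  have hψX : ∀ e, ψ (X e) = if e = s(u, v) then ι (X s(u, v)) / ι (X s(v, v)) else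
    if e = s(u, u) then ι (X s(u, u)) - ι (X s(u, v)) ^ 2 / ι (X s(v, v)) else ι (X e) :=
    fun e => by rw [hψ, aeval_X]
  have h1 : ψ (X s(v, v)) = ι (X s(v, v)) := by
    rw [hψX, if_neg, if_neg] <;> simp [huv.symm]
  have h2 : ψ (X s(u, v)) = ι (X s(u, v)) / ι (X s(v, v)) := by rw [hψX, if_pos rfl]
  have h3 : ψ (X s(u, u)) = ι (X s(u, u)) - ι (X s(u, v)) ^ 2 / ι (X s(v, v)) := by
    rw [hψX, if_neg, if_pos rfl]; simp [huv]
  have h4 : ψ.comp (tau K u v) = ι := by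
    apply MvPolynomial.algHom_ext
    intro e
    rw [AlgHom.comp_apply, tau_X]
    split_ifs with h5 h6
    · rw [map_mul, h1, h2, h5]; exact fld1 _ _ ha
    · rw [map_add, map_mul, map_pow, h1, h2, h3, h6]; exact fld2 _ _ _ ha
    · rw [hψX, if_neg h5, if_neg h6]
  intro p q hpq
  apply hι
  rw [← h4, AlgHom.comp_apply, AlgHom.comp_apply, hpq]

lemma tau_clear (huv : u ≠ v) (p : MvPolynomial (Sym2 (Fin n)) K) :
    ∃ k, ∀ m, k ≤ m → ∃ q, tau K u v q = X s(v, v) ^ m * p := by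
  suffices ∃ k q, tau K u v q = X s(v, v) ^ k * p by
    obtain ⟨k, q, hq⟩ := this
    refine ⟨k, fun m hm => ⟨X s(v, v) ^ (m - k) * q, ?_⟩⟩
    rw [map_mul, map_pow, tau_a huv, hq, ← mul_assoc, ← pow_add, Nat.sub_add_cancel hm]
  induction p using MvPolynomial.induction_on with
  | C c => exact ⟨0, C c, by simp [tau]⟩
  | add p q hp hq =>
    obtain ⟨k, p', hp⟩ := hp
    obtain ⟨l, q', hq⟩ := hq
    refine ⟨k + l, X s(v, v) ^ l * p' + X s(v, v) ^ k * q', ?_⟩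
    rw [map_add, map_mul, map_mul, map_pow, map_pow, tau_a huv, hp, hq]; ring
  | mul_X p e hp =>
    obtain ⟨k, p', hp⟩ := hp
    have : ∃ q, tau K u v q = X s(v, v) * X e := by
      by_cases h1 : e = s(u, v)
      · exact ⟨X s(u, v), by rw [tau_x, h1]⟩
      by_cases h2 : e = s(u, u)
      · exact ⟨X s(v, v) * X s(u, u) - X s(u, v) ^ 2, by
          rw [map_sub, map_mul, map_pow, tau_a huv, tau_x, tau_b huv, h2]; ring⟩
      · exact ⟨X s(v, v) * X e, by
          rw [map_mul, tau_a huv, tau_X, if_neg h1, if_neg h2]⟩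
    obtain ⟨q, hq⟩ := this
    exact ⟨k + 1, p' * q, by rw [map_mul, hp, hq]; ring⟩

lemma tau_clear_mat (huv : u ≠ v) (B : Matrix (Fin n) (Fin n) (MvPolynomial (Sym2 (Fin n)) K)) :
    ∃ k, ∃ B' : Matrix (Fin n) (Fin n) (MvPolynomial (Sym2 (Fin n)) K),
      B'.map (tau K u v) = (X s(v, v) : MvPolynomial (Sym2 (Fin n)) K) ^ k • B := by
  have h := fun i j => tau_clear huv (B i j)
  choose k hk using h
  set m := Finset.univ.sup fun p : Fin n × Fin n => k p.1 p.2 with hm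
  have h2 : ∀ i j, ∃ q, tau K u v q = X s(v, v) ^ m * B i j := fun i j =>
    hk i j m (Finset.le_sup (f := fun p : Fin n × Fin n => k p.1 p.2) (Finset.mem_univ (i, j)))
  choose B' hB' using h2
  exact ⟨m, Matrix.of B', by ext1 i j; simp [hB']⟩

lemma tau_XQ (huv : u ≠ v) {Q' : Set (Sym2 (Fin n))} (hdg : dg n ⊆ Q')
    (hv : ∀ j, s(v, j) ∈ Q' → j = v) :
    (XQ K (insert s(u, v) Q')).map (tau K u v) =
      (Matrix.transvection v u (X s(u, v))).transpose * XQ K Q' *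
        Matrix.transvection v u (X s(u, v)) := by
  set x : MvPolynomial (Sym2 (Fin n)) K := X s(u, v) with hx
  set a : MvPolynomial (Sym2 (Fin n)) K := X s(v, v) with ha
  have hvv : XQ K Q' v v = a := by rw [XQ_apply, if_pos (hdg ((mem_dg v v).2 rfl))]
  have hv1 : ∀ j, j ≠ v → XQ K Q' v j = 0 := fun j hj => by
    rw [XQ_apply, if_neg fun h => hj (hv j h)]
  have hv2 : ∀ j, j ≠ v → XQ K Q' j v = 0 := fun j hj => by
    rw [← (XQ_symm (K := K) Q').apply, hv1 j hj]
  have e1 : XQ K Q' * Matrix.single v u x = Matrix.single v u (a * x) := by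
    ext1 i j
    rw [Matrix.mul_apply, Finset.sum_eq_single v]
    · by_cases hi : i = v
      · rw [hi, hvv]; by_cases hj : u = j <;> simp [Matrix.single_apply, hj]
      · rw [hv2 i hi]; simp [Matrix.single_apply, Ne.symm hi]
    · intro k _ hk; simp [Matrix.single_apply, hk.symm]
    · simp
  have e2 : Matrix.single u v x * XQ K Q' = Matrix.single u v (a * x) := by
    have := congrArg Matrix.transpose e1
    rwa [Matrix.transpose_mul, (XQ_symm (K := K) Q').eq, Matrix.transpose_single,
      Matrix.transpose_single] at this
  have e3 : (Matrix.transvection v u x).transpose * XQ K Q' * Matrix.transvection v u x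
      = XQ K Q' + Matrix.single v u (a * x) + Matrix.single u v (a * x)
        + Matrix.single u u (a * x ^ 2) := by
    rw [Matrix.transvection, Matrix.transpose_add, Matrix.transpose_one, Matrix.transpose_single,
      Matrix.add_mul, Matrix.one_mul, Matrix.mul_add, Matrix.mul_one, e2, Matrix.add_mul, e1,
      Matrix.single_mul_single_same]
    rw [show a * x * x = a * x ^ 2 by ring]
    abel
  have hnot : s(u, v) ∉ Q' := fun h => huv (hv u (by rwa [Sym2.eq_swap]))
  rw [e3]
  ext1 i j
  rw [Matrix.map_apply, XQ_apply, Matrix.add_apply, Matrix.add_apply, Matrix.add_apply, XQ_apply,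
    Matrix.single_apply, Matrix.single_apply, Matrix.single_apply]
  by_cases h1 : s(i, j) = s(u, v)
  · rw [if_pos (show s(i, j) ∈ insert s(u, v) Q' from Set.mem_insert_iff.2 (Or.inl h1)), h1, tau_x,
      if_neg hnot]
    rcases Sym2.eq_iff.1 h1 with ⟨rfl, rfl⟩ | ⟨rfl, rfl⟩
    · simp [huv, huv.symm, hx, ha]
    · simp [huv, huv.symm, hx, ha]
  · have h3 : ¬ (v = i ∧ u = j) := fun h => h1 (by rw [← h.1, ← h.2, Sym2.eq_swap])
    have h4 : ¬ (u = i ∧ v = j) := fun h => h1 (by rw [← h.1, ← h.2])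
    rw [if_neg h3, if_neg h4, add_zero, add_zero]
    by_cases h2 : s(i, j) = s(u, u)
    · have h5 : i = u ∧ j = u := by simpa using h2
      have h6 : s(i, j) ∈ Q' := hdg (by rw [h2]; exact (mem_dg u u).2 rfl)
      rw [if_pos (Set.mem_insert_of_mem _ h6), if_pos h6, if_pos ⟨h5.1.symm, h5.2.symm⟩, h2,
        tau_b huv]
    · have h5 : ¬ (u = i ∧ u = j) := fun h => h2 (by rw [← h.1, ← h.2])
      rw [if_neg h5, add_zero]
      by_cases h6 : s(i, j) ∈ Q'
      · rw [if_pos (Set.mem_insert_of_mem _ h6), if_pos h6, tau_X, if_neg h1, if_neg h2]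
      · rw [if_neg (by rw [Set.mem_insert_iff]; tauto), if_neg h6, map_zero]

lemma E1_pend (huv : u ≠ v) {r r' : Fin n → Fin n → Prop} (hr' : Equivalence r')
    (hr : Equivalence r)
    {Q' : Set (Sym2 (Fin n))} (hdg : dg n ⊆ Q') (hv : ∀ j, s(v, j) ∈ Q' → j = v)
    (hrr : ∀ i j, i ≠ v → j ≠ v → r i j → r' i j) (hruv : r v u)
    (hblk : ∀ i j, s(i, j) ∈ Q' → r' i j) (hE : E1 K r' Q') :
    E1 K r (insert s(u, v) Q') := by
  intro M hM ht
  set Y := XQ K (insert s(u, v) Q') with hY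
  set τ := tau K u v with hτ
  set x : MvPolynomial (Sym2 (Fin n)) K := X s(u, v) with hx
  set a : MvPolynomial (Sym2 (Fin n)) K := X s(v, v) with ha
  set P := Matrix.transvection v u x with hP
  set P' := Matrix.transvection v u (-x) with hP'
  have hPP' : P * P' = 1 := by
    rw [hP, hP', Matrix.transvection_mul_transvection_same _ _ huv.symm, add_neg_cancel,
      Matrix.transvection_zero]
  have hP'P : P' * P = 1 := by
    rw [hP, hP', Matrix.transvection_mul_transvection_same _ _ huv.symm, neg_add_cancel,
      Matrix.transvection_zero]
  have hPP't : P.transpose * P'.transpose = 1 := by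
    rw [← Matrix.transpose_mul, hP'P, Matrix.transpose_one]
  have hP'Pt : P'.transpose * P.transpose = 1 := by
    rw [← Matrix.transpose_mul, hPP', Matrix.transpose_one]
  have hdet : P'.det = 1 := Matrix.det_transvection_of_ne _ _ huv.symm _
  have hτY : Y.map τ = P.transpose * XQ K Q' * P := tau_XQ huv hdg hv
  have hX1 : XQ K Q' = P'.transpose * Y.map τ * P' := by
    rw [hτY]
    calc XQ K Q' = (P'.transpose * P.transpose) * XQ K Q' * (P * P') := by
          rw [hP'Pt, hPP', Matrix.one_mul, Matrix.mul_one]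
      _ = _ := by simp only [Matrix.mul_assoc]
  have hP'b : IsBlk r P' := fun i j hij => by
    rw [hP', Matrix.transvection, Matrix.add_apply, Matrix.one_apply, Matrix.single_apply,
      if_neg (fun h : i = j => hij (h ▸ hr.refl i)),
      if_neg (fun h : v = i ∧ u = j => hij (by rw [← h.1, ← h.2]; exact hruv)),
      add_zero]
  have hP'tb : IsBlk r P'.transpose := fun i j hij => by
    rw [Matrix.transpose_apply]; exact hP'b j i fun h => hij (hr.symm h)
  obtain ⟨B1, hB1t, hB1a⟩ := torsion hr' hdg hv hrr hblk hE
    (M := P'.transpose * M.map τ * P') ((hP'tb.mul hr (hM.map τ)).mul hr hP'b) (by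
      rw [hX1, Matrix.adjugate_mul_distrib, Matrix.adjugate_mul_distrib]
      have e1 : P'.adjugate * ((Y.map τ).adjugate * P'.transpose.adjugate) *
          (P'.transpose * M.map τ * P')
          = P'.adjugate * ((Y.map τ).adjugate * (P'.transpose.adjugate * P'.transpose) * M.map τ) * P' := by
        simp only [Matrix.mul_assoc]
      rw [e1, Matrix.adjugate_mul, Matrix.det_transpose, hdet, one_smul, Matrix.mul_one,
        Matrix.trace_mul_comm, ← Matrix.mul_assoc, Matrix.mul_adjugate, hdet, one_smul,
        Matrix.one_mul]
      have e2 : (Y.map τ).adjugate = Y.adjugate.map τ := (τ.map_adjugate Y).symm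
      have e3 : (Y.adjugate * M).map τ = Y.adjugate.map τ * M.map τ := Matrix.map_mul
      rw [e2, ← e3]
      have e4 : ((Y.adjugate * M).map τ).trace = τ (Y.adjugate * M).trace := by
        simp only [Matrix.trace, map_sum, Matrix.diag_apply, Matrix.map_apply]
      rw [e4, ht, map_zero])
  set B2 := P' * B1 * P with hB2
  have hB2t : B2.trace = 0 := by
    rw [hB2, Matrix.trace_mul_comm, ← Matrix.mul_assoc, hPP', Matrix.one_mul, hB1t]
  have hB2a : Alt (a • M.map τ - Y.map τ * B2) := by
    have h1 := hB1a.conj P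
    rw [conj_calc a hPP' hP'P hPP't, ← hτY] at h1
    exact h1
  obtain ⟨k, B3, hB3⟩ := tau_clear_mat huv B2
  have hτi := tau_inj (K := K) huv
  have hB3t : B3.trace = 0 := by
    apply hτi
    have e4 : (B3.map τ).trace = τ B3.trace := by
      simp only [Matrix.trace, map_sum, Matrix.diag_apply, Matrix.map_apply]
    rw [← hτ, ← e4, hB3, Matrix.trace_smul, hB2t, smul_zero, map_zero]
  have hB3a : Alt (a ^ (k + 1) • M - Y * B3) := by
    apply Alt.of_map τ hτi
    have : (a ^ (k + 1) • M - Y * B3).map τ = a ^ k • (a • M.map τ - Y.map τ * B2) := by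
      rw [smul_sub, ← Matrix.mul_smul, ← hB3, smul_smul, ← pow_succ]
      have e3 : Y.map τ * B3.map τ = (Y * B3).map τ := Matrix.map_mul.symm
      rw [e3]
      ext1 i j
      simp only [Matrix.map_apply, Matrix.sub_apply, map_sub, Matrix.smul_apply, smul_eq_mul,
        map_mul, map_pow]
      rw [hτ, ha, tau_a huv]
    rw [this]
    exact hB2a.smul _
  have hmem : s(v, v) ∈ Q' := hdg ((mem_dg v v).2 rfl)
  have hins : insert s(v, v) (insert s(u, v) Q' \ {s(v, v)}) = insert s(u, v) Q' := by
    rw [Set.insert_sdiff_singleton, Set.insert_eq_of_mem (Set.mem_insert_of_mem _ hmem)]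
  have hE2 : E2 K (insert s(u, v) Q' \ {s(v, v)}) := by
    refine E2_mono ?_ (E2_Q0 huv)
    rintro e (⟨i, hi, rfl⟩ | rfl)
    · exact ⟨Set.mem_insert_of_mem _ (hdg ((mem_dg i i).2 rfl)), by simp [hi]⟩
    · exact ⟨Set.mem_insert _ _, by simp [huv]⟩
  have := descent (v := v) (Q := insert s(u, v) Q' \ {s(v, v)}) (by simp) hE2 M (k + 1) B3 hB3t
  rw [hins] at this
  exact this hB3a

end
end pend
end SMin


namespace SMin

section graph
variable {n : ℕ} {K : Type*} [Field K]

/-- partial reachability relation -/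
def rS (G : SimpleGraph (Fin n)) (S : Set (Fin n)) (i j : Fin n) : Prop :=
  i = j ∨ (i ∈ S ∧ j ∈ S ∧ G.Reachable i j)

lemma rS_equiv (G : SimpleGraph (Fin n)) (S : Set (Fin n)) : Equivalence (rS G S) := by
  refine ⟨fun i => Or.inl rfl, ?_, ?_⟩
  · rintro i j (h | ⟨h1, h2, h3⟩)
    · exact Or.inl h.symm
    · exact Or.inr ⟨h2, h1, h3.symm⟩
  · rintro i j k (rfl | ⟨h1, h2, h3⟩)
    · exact id
    · rintro (rfl | ⟨h4, h5, h6⟩)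
      · exact Or.inr ⟨h1, h2, h3⟩
      · exact Or.inr ⟨h1, h5, h3.trans h6⟩

lemma grow (G : SimpleGraph (Fin n)) (m : ℕ) :
    ∀ (S : Set (Fin n)) (Q : Set (Sym2 (Fin n))), (Sᶜ).ncard = m →
      (∀ i, ∃ j ∈ S, G.Reachable j i) → dg n ⊆ Q → Q ⊆ dg n ∪ G.edgeSet →
      (∀ i j, s(i, j) ∈ Q → rS G S i j) → E1 K (rS G S) Q →
      E1 K (rS G Set.univ) (dg n ∪ G.edgeSet) := by
  induction m with
  | zero =>
    intro S Q hm _ hdg hQ hr hE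
    have : S = Set.univ := by
      rw [Set.ncard_eq_zero (Set.toFinite _)] at hm
      exact Set.compl_empty_iff.1 hm
    subst this
    refine E1_mono (rS_equiv G _) hQ (fun i j hij => ?_) hE
    rcases hij with h | h
    · exact Or.inl ((mem_dg i j).1 h)
    · exact Or.inr ⟨trivial, trivial, (SimpleGraph.Adj.reachable h)⟩
  | succ m ih =>
    intro S Q hm hroot hdg hQ hr hE
    obtain ⟨q0, hq0⟩ : (Sᶜ).Nonempty := by
      apply Set.nonempty_of_ncard_ne_zero; omega
    obtain ⟨p0, hp0, ⟨w⟩⟩ := hroot q0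
    obtain ⟨d, _, hd1, hd2⟩ := w.exists_boundary_dart S hp0 hq0
    set u := d.fst
    set v := d.snd
    have hadj : G.Adj u v := d.adj
    have huv : u ≠ v := hadj.ne
    apply ih (insert v S) (insert s(u, v) Q)
    · have h1 : (insert v S)ᶜ = Sᶜ \ {v} := by
        ext k; simp [and_comm]
      rw [h1, Set.ncard_sdiff_singleton_of_mem hd2, hm]
      rfl
    · intro i
      obtain ⟨j, hj, h⟩ := hroot i
      exact ⟨j, Set.mem_insert_of_mem _ hj, h⟩
    · exact hdg.trans (Set.subset_insert _ _)
    · rw [Set.insert_subset_iff]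
      exact ⟨Or.inr hadj, hQ⟩
    · intro i j hij
      rcases Set.mem_insert_iff.1 hij with h | h
      · rcases Sym2.eq_iff.1 h with ⟨rfl, rfl⟩ | ⟨rfl, rfl⟩
        · exact Or.inr ⟨Set.mem_insert_of_mem _ hd1, Set.mem_insert _ _, hadj.reachable⟩
        · exact Or.inr ⟨Set.mem_insert _ _, Set.mem_insert_of_mem _ hd1, hadj.reachable.symm⟩
      · rcases hr i j h with h1 | ⟨h1, h2, h3⟩
        · exact Or.inl h1
        · exact Or.inr ⟨Set.mem_insert_of_mem _ h1, Set.mem_insert_of_mem _ h2, h3⟩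
    · refine E1_pend huv (rS_equiv G S) (rS_equiv G _) hdg ?_ ?_ ?_ hr hE
      · intro j hj
        rcases hr v j hj with h1 | ⟨h1, h2, h3⟩
        · exact h1.symm
        · exact absurd h1 hd2
      · rintro i j hi hj (h | ⟨h1, h2, h3⟩)
        · exact Or.inl h
        · exact Or.inr ⟨(Set.mem_insert_iff.1 h1).resolve_left hi,
            (Set.mem_insert_iff.1 h2).resolve_left hj, h3⟩
      · exact Or.inr ⟨Set.mem_insert _ _, Set.mem_insert_of_mem _ hd1, hadj.reachable.symm⟩

lemma E1_graph (G : SimpleGraph (Fin n)) : E1 K G.Reachable (dg n ∪ G.edgeSet) := by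
  have h : rS G Set.univ = G.Reachable := by
    funext i j
    apply propext
    constructor
    · rintro (rfl | ⟨_, _, h⟩)
      · exact SimpleGraph.Reachable.refl _
      · exact h
    · intro h; exact Or.inr ⟨trivial, trivial, h⟩
  rw [← h]
  set f : G.ConnectedComponent → Fin n := fun c => Quot.out c
  have hf : ∀ c, G.connectedComponentMk (f c) = c := fun c => Quot.out_eq c
  have h2 : rS G (Set.range f) = (· = ·) := by
    funext i j
    apply propext
    constructor
    · rintro (h | ⟨⟨c, rfl⟩, ⟨c', rfl⟩, h⟩)
      · exact h
      · have := SimpleGraph.ConnectedComponent.eq.2 h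
        rw [hf, hf] at this
        show f c = f c'
        rw [this]
    · intro h; exact Or.inl h
  refine grow G _ (Set.range f) (dg n) rfl ?_ le_rfl Set.subset_union_left ?_ ?_
  · intro i
    exact ⟨_, ⟨G.connectedComponentMk i, rfl⟩, SimpleGraph.ConnectedComponent.eq.1 (hf _)⟩
  · intro i j hij
    exact Or.inl ((mem_dg i j).1 hij)
  · rw [h2]; exact E1_dg

lemma E2_graph (G : SimpleGraph (Fin n)) : E2 K (dg n ∪ G.edgeSet) :=
  E2_mono Set.subset_union_left E2_dg

end graph
end SMin


namespace SMin

section rho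
variable {σ K : Type*} [Field K]

/-- killing the variables outside `Q` -/
noncomputable def rho (K : Type*) [Field K] (Q : Set σ) : MvPolynomial σ K →ₐ[K] MvPolynomial σ K :=
  aeval fun e => if e ∈ Q then X e else 0

lemma rho_X (Q : Set σ) (e : σ) : rho K Q (X e) = if e ∈ Q then X e else 0 := by
  rw [rho, aeval_X]

lemma rho_monomial (Q : Set σ) (s : σ →₀ ℕ) (c : K) :
    rho K Q (monomial s c) = if (s.support : Set σ) ⊆ Q then monomial s c else 0 := by
  rw [rho, aeval_monomial, algebraMap_eq]
  split_ifs with h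
  · rw [monomial_eq]
    congr 1
    refine Finsupp.prod_congr fun i hi => ?_
    rw [if_pos (h hi)]
  · obtain ⟨i, hi, hiQ⟩ := Set.not_subset.1 h
    have : s.prod (fun i k => (if i ∈ Q then (X i : MvPolynomial σ K) else 0) ^ k) = 0 := by
      refine Finset.prod_eq_zero hi ?_
      simp only
      rw [if_neg hiQ, zero_pow (Finsupp.mem_support_iff.1 hi)]
    rw [this, mul_zero]

lemma coeff_rho (Q : Set σ) (s : σ →₀ ℕ) (p : MvPolynomial σ K) :
    coeff s (rho K Q p) = if (s.support : Set σ) ⊆ Q then coeff s p else 0 := by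
  induction p using MvPolynomial.induction_on' with
  | monomial t c =>
    rw [rho_monomial]
    by_cases hst : t = s
    · subst hst; split_ifs <;> simp
    · split_ifs <;> simp [coeff_monomial, hst]
  | add p q hp hq =>
    rw [map_add, coeff_add, coeff_add, hp, hq]
    split_ifs <;> simp

lemma rho_rho (Q : Set σ) (p : MvPolynomial σ K) : rho K Q (rho K Q p) = rho K Q p := by
  ext s
  rw [coeff_rho, coeff_rho]
  split_ifs <;> rfl

lemma rho_hc (Q : Set σ) (k : ℤ) (p : MvPolynomial σ K) :
    rho K Q (hc k p) = hc k (rho K Q p) := by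
  unfold hc
  split_ifs with h
  · ext s
    rw [coeff_rho, coeff_homogeneousComponent, coeff_homogeneousComponent, coeff_rho]
    split_ifs <;> rfl
  · simp

/-- polynomials in the variables in `Q`, homogeneous of degree `k` -/
noncomputable def V (K : Type*) [Field K] (Q : Set σ) (k : ℤ) : Submodule K (MvPolynomial σ K) :=
  gr σ K k ⊓ LinearMap.eqLocus (rho K Q).toLinearMap LinearMap.id

lemma mem_V {Q : Set σ} {k : ℤ} {p : MvPolynomial σ K} :
    p ∈ V K Q k ↔ p ∈ gr σ K k ∧ rho K Q p = p := by
  rw [V, Submodule.mem_inf, LinearMap.mem_eqLocus]; rfl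

lemma rho_hc_mem_V (Q : Set σ) (k : ℤ) (p : MvPolynomial σ K) : rho K Q (hc k p) ∈ V K Q k :=
  mem_V.2 ⟨by rw [rho_hc]; exact hc_mem _ _, rho_rho _ _⟩

lemma rho_gr_mem_V {Q : Set σ} {k : ℤ} {p : MvPolynomial σ K} (h : p ∈ gr σ K k) :
    rho K Q p ∈ V K Q k := by
  rw [← hc_of_mem h]; exact rho_hc_mem_V _ _ _

lemma rho_hc_of_mem_V {Q : Set σ} {k : ℤ} {p : MvPolynomial σ K} (h : p ∈ V K Q k) :
    rho K Q (hc k p) = p := by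
  rw [hc_of_mem (mem_V.1 h).1, (mem_V.1 h).2]

lemma V_neg {Q : Set σ} {k : ℤ} (h : k < 0) : V K Q k = ⊥ := by
  rw [V, gr_neg h, bot_inf_eq]

lemma weight_one_sum (s : σ →₀ ℕ) : Finsupp.weight (1 : σ → ℕ) s = s.sum fun _ x => x := by
  have h : Finsupp.weight (1 : σ → ℕ) s = s.degree := by
    rw [Finsupp.degree_eq_weight_one]; rfl
  rw [h]; rfl

lemma V_nat [Fintype σ] {Q : Set σ} (m : ℕ) :
    V K Q m = restrictSupport K (Q.toFinset.finsuppAntidiag m : Set (σ →₀ ℕ)) := by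
  ext p
  rw [mem_V, gr_nat, mem_homogeneousSubmodule, mem_restrictSupport_iff]
  constructor
  · rintro ⟨h1, h2⟩ s hs
    rw [Finset.mem_coe, mem_support_iff] at hs
    rw [Finset.mem_coe, Finset.mem_finsuppAntidiag']
    constructor
    · have := h1 hs
      rw [weight_one_sum] at this
      exact this
    · rw [← h2, coeff_rho] at hs
      intro i hi
      rw [Set.mem_toFinset]
      by_contra hiQ
      exact hs (if_neg fun h => hiQ (h hi))
  · intro h
    have h' : ∀ s, coeff s p ≠ 0 → (s.sum fun _ x => x) = m ∧ s.support ⊆ Q.toFinset := fun s hs => by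
      have := h (Finset.mem_coe.2 (mem_support_iff.2 hs))
      rwa [Finset.mem_coe, Finset.mem_finsuppAntidiag'] at this
    constructor
    · intro s hs
      rw [weight_one_sum]
      exact (h' s hs).1
    · ext s
      rw [coeff_rho]
      split_ifs with h1
      · rfl
      · by_contra h2
        apply h1
        intro i hi
        exact Set.mem_toFinset.1 ((h' s (Ne.symm h2)).2 hi)

instance [Fintype σ] (Q : Set σ) (k : ℤ) : FiniteDimensional K (V K Q k) := by
  rcases lt_or_ge k 0 with h | h
  · rw [V_neg h]; infer_instance
  · obtain ⟨m, rfl⟩ := Int.eq_ofNat_of_zero_le h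
    rw [V_nat]
    exact Module.Finite.of_basis (basisRestrictSupport K _)

lemma finrank_V [Fintype σ] (Q : Set σ) (N : ℕ) (hN : Nat.card Q = N) (hpos : 0 < N) (k : ℤ) :
    (Module.finrank K (V K Q k) : ℤ) = intChoose (k + N - 1) (N - 1) := by
  rcases lt_or_ge k 0 with h | h
  · rw [V_neg h, finrank_bot, intChoose, if_pos (by omega)]; rfl
  · obtain ⟨m, rfl⟩ := Int.eq_ofNat_of_zero_le h
    rw [V_nat, Module.finrank_eq_card_basis (basisRestrictSupport K _), intChoose,
      if_neg (by omega), ← Nat.card_eq_fintype_card, Nat.card_coe_set_eq, Set.ncard_coe_finset,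
      Finset.card_finsuppAntidiag_nat_eq_choose]
    have : Q.toFinset.card = N := by
      rw [← hN, Nat.card_eq_fintype_card, Set.toFinset_card]
    rw [this, show ((m : ℤ) + N - 1).toNat = N + m - 1 by omega,
      show ((N : ℤ) - 1).toNat = N - 1 by omega]
    congr 1
    rw [← Nat.choose_symm (by omega)]
    congr 1
    omega

end rho

lemma finrank_map_add {K M M' : Type*} [Field K] [AddCommGroup M] [Module K M] [AddCommGroup M']
    [Module K M'] (f : M →ₗ[K] M') (p : Submodule K M) [FiniteDimensional K p] :
    Module.finrank K (p.map f) + Module.finrank K (p ⊓ LinearMap.ker f : Submodule K M)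
      = Module.finrank K p := by
  have h := LinearMap.finrank_range_add_finrank_ker (f.domRestrict p)
  rw [LinearMap.range_domRestrict] at h
  rw [← h]
  congr 1
  have h2 : (LinearMap.ker (f.domRestrict p)).map p.subtype = p ⊓ LinearMap.ker f := by
    ext x
    simp only [Submodule.mem_map, LinearMap.mem_ker, Submodule.mem_inf]
    constructor
    · rintro ⟨y, hy, rfl⟩
      exact ⟨y.2, hy⟩
    · rintro ⟨h3, h4⟩
      exact ⟨⟨x, h3⟩, h4, rfl⟩
  rw [← h2]
  exact (Submodule.equivSubtypeMap p (LinearMap.ker (f.domRestrict p))).symm.finrank_eq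

end SMin


namespace SMin

section count
variable {n : ℕ} {K : Type*} [Field K]

lemma IsBlk.transpose {R : Type*} [CommRing R] {r : Fin n → Fin n → Prop} (hr : Equivalence r)
    {M : Matrix (Fin n) (Fin n) R} (h : IsBlk r M) : IsBlk r M.transpose :=
  fun i j hij => h j i fun h' => hij (hr.symm h')

lemma blk_transpose {R : Type*} [CommRing R] {r : Fin n → Fin n → Prop} (hr : Equivalence r)
    (M : Matrix (Fin n) (Fin n) R) : blk r M.transpose = (blk r M).transpose := by
  ext i j
  simp only [blk, Matrix.transpose_apply]
  by_cases h : r i j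
  · rw [if_pos h, if_pos (hr.symm h)]
  · rw [if_neg h, if_neg fun h' => h (hr.symm h')]

lemma blk_mul' {R : Type*} [CommRing R] {r : Fin n → Fin n → Prop} (hr : Equivalence r)
    {X : Matrix (Fin n) (Fin n) R} (hX : IsBlk r X)
    (B : Matrix (Fin n) (Fin n) R) : blk r (B * X) = blk r B * X := by
  have := blk_mul hr (hX.transpose hr) B.transpose
  rw [← Matrix.transpose_mul, blk_transpose hr, blk_transpose hr, ← Matrix.transpose_mul] at this
  exact Matrix.transpose_injective this

/-- block matrices with entries of degree `k` in the variables `Q` -/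
noncomputable def W (K : Type*) [Field K] (r : Fin n → Fin n → Prop) (Q : Set (Sym2 (Fin n))) (k : ℤ) :
    Submodule K (Matrix (Fin n) (Fin n) (MvPolynomial (Sym2 (Fin n)) K)) where
  carrier := {M | IsBlk r M ∧ ∀ i j, M i j ∈ V K Q k}
  add_mem' := fun ha hb => ⟨ha.1.add hb.1, fun i j => Submodule.add_mem _ (ha.2 i j) (hb.2 i j)⟩
  zero_mem' := ⟨fun _ _ _ => rfl, fun _ _ => Submodule.zero_mem _⟩
  smul_mem' := fun c M h => ⟨fun i j hij => by rw [Matrix.smul_apply, h.1 i j hij, smul_zero],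
    fun i j => Submodule.smul_mem _ c (h.2 i j)⟩

/-- alternating elements of `W` -/
noncomputable def Al (K : Type*) [Field K] (r : Fin n → Fin n → Prop) (Q : Set (Sym2 (Fin n))) (k : ℤ) :
    Submodule K (Matrix (Fin n) (Fin n) (MvPolynomial (Sym2 (Fin n)) K)) where
  carrier := {M | M ∈ W K r Q k ∧ Alt M}
  add_mem' := fun ha hb => ⟨Submodule.add_mem _ ha.1 hb.1, ha.2.add hb.2⟩
  zero_mem' := ⟨Submodule.zero_mem _, Alt.zero⟩
  smul_mem' := fun c M h => ⟨Submodule.smul_mem _ c h.1, by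
    have := h.2.smul (MvPolynomial.C c : MvPolynomial (Sym2 (Fin n)) K)
    refine ⟨fun i => ?_, fun i j => ?_⟩
    · rw [Matrix.smul_apply, h.2.1, smul_zero]
    · rw [Matrix.smul_apply, Matrix.smul_apply, h.2.2 i j, smul_neg]⟩

variable {r : Fin n → Fin n → Prop} {Q : Set (Sym2 (Fin n))}

lemma mem_W {k : ℤ} {M : Matrix (Fin n) (Fin n) (MvPolynomial (Sym2 (Fin n)) K)} :
    M ∈ W K r Q k ↔ IsBlk r M ∧ ∀ i j, M i j ∈ V K Q k := Iff.rfl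

lemma mem_Al {k : ℤ} {M : Matrix (Fin n) (Fin n) (MvPolynomial (Sym2 (Fin n)) K)} :
    M ∈ Al K r Q k ↔ M ∈ W K r Q k ∧ Alt M := Iff.rfl

/-- restriction of a block matrix to the entries in the blocks -/
noncomputable def resW (K : Type*) [Field K] (r : Fin n → Fin n → Prop) (Q : Set (Sym2 (Fin n))) (k : ℤ) :
    W K r Q k →ₗ[K] ({p : Fin n × Fin n // r p.1 p.2} → V K Q k) where
  toFun M := fun s => ⟨M.1 s.1.1 s.1.2, M.2.2 _ _⟩
  map_add' := fun _ _ => rfl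
  map_smul' := fun _ _ => rfl

noncomputable def resAl (K : Type*) [Field K] (r : Fin n → Fin n → Prop) (Q : Set (Sym2 (Fin n))) (k : ℤ) :
    Al K r Q k →ₗ[K] ({p : Fin n × Fin n // p.1 < p.2 ∧ r p.1 p.2} → V K Q k) where
  toFun M := fun s => ⟨M.1 s.1.1 s.1.2, M.2.1.2 _ _⟩
  map_add' := fun _ _ => rfl
  map_smul' := fun _ _ => rfl

lemma resW_bij (k : ℤ) : Function.Bijective (resW K r Q k) := by
  constructor
  · intro A B h
    apply Subtype.ext
    ext1 i j
    by_cases hij : r i j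
    · exact congrArg Subtype.val (congrFun h ⟨(i, j), hij⟩)
    · rw [A.2.1 i j hij, B.2.1 i j hij]
  · intro f
    refine ⟨⟨Matrix.of fun i j => if h : r i j then (f ⟨(i, j), h⟩).1 else 0, ?_, ?_⟩, ?_⟩
    · intro i j h
      rw [Matrix.of_apply, dif_neg h]
    · intro i j
      rw [Matrix.of_apply]
      split_ifs with h
      · exact (f _).2
      · exact Submodule.zero_mem _
    · funext s
      apply Subtype.ext
      change (if h : r s.1.1 s.1.2 then (f ⟨(s.1.1, s.1.2), h⟩).1 else 0) = _
      rw [dif_pos s.2]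

lemma resAl_bij (hr : Equivalence r) (k : ℤ) : Function.Bijective (resAl K r Q k) := by
  constructor
  · intro A B h
    have key : ∀ i j, i < j → A.1 i j = B.1 i j := fun i j hlt => by
      by_cases hij : r i j
      · exact congrArg Subtype.val (congrFun h ⟨(i, j), hlt, hij⟩)
      · rw [A.2.1.1 i j hij, B.2.1.1 i j hij]
    apply Subtype.ext
    ext1 i j
    rcases lt_trichotomy i j with hl | rfl | hl
    · exact key i j hl
    · rw [A.2.2.1, B.2.2.1]
    · rw [A.2.2.2, B.2.2.2, key j i hl]
  · intro f
    set g : Fin n → Fin n → MvPolynomial (Sym2 (Fin n)) K := fun i j =>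
      if h : i < j ∧ r i j then (f ⟨(i, j), h⟩).1 else 0 with hg
    have g0 : ∀ i j, ¬ (i < j ∧ r i j) → g i j = 0 := fun i j h => dif_neg h
    have gV : ∀ i j, g i j ∈ V K Q k := fun i j => by
      rw [hg]; dsimp only
      split_ifs with h
      · exact (f _).2
      · exact Submodule.zero_mem _
    refine ⟨⟨Matrix.of fun i j => g i j - g j i, ⟨?_, ?_⟩, ?_, ?_⟩, ?_⟩
    · intro i j h
      rw [Matrix.of_apply, g0 i j fun h' => h h'.2, g0 j i fun h' => h (hr.symm h'.2), sub_zero]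
    · intro i j
      exact Submodule.sub_mem _ (gV i j) (gV j i)
    · intro i; rw [Matrix.of_apply, sub_self]
    · intro i j; rw [Matrix.of_apply, Matrix.of_apply, neg_sub]
    · funext s
      apply Subtype.ext
      change g s.1.1 s.1.2 - g s.1.2 s.1.1 = _
      rw [g0 s.1.2 s.1.1 fun h => lt_asymm h.1 s.2.1, sub_zero]
      exact dif_pos s.2

instance finW (k : ℤ) : FiniteDimensional K (W K r Q k) :=
  Module.Finite.equiv (LinearEquiv.ofBijective _ (resW_bij k)).symm

instance finAl (k : ℤ) : FiniteDimensional K (Al K r Q k) :=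
  Submodule.finiteDimensional_of_le (S₂ := W K r Q k) fun _ h => h.1

lemma finrank_W (k : ℤ) : Module.finrank K (W K r Q k) =
    Nat.card {p : Fin n × Fin n // r p.1 p.2} * Module.finrank K (V K Q k) := by
  rw [(LinearEquiv.ofBijective _ (resW_bij k)).finrank_eq, Module.finrank_pi_fintype,
    Finset.sum_const, Finset.card_univ, smul_eq_mul, Nat.card_eq_fintype_card]

lemma finrank_Al (hr : Equivalence r) (k : ℤ) : Module.finrank K (Al K r Q k) =
    Nat.card {p : Fin n × Fin n // p.1 < p.2 ∧ r p.1 p.2} * Module.finrank K (V K Q k) := by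
  rw [(LinearEquiv.ofBijective _ (resAl_bij hr k)).finrank_eq, Module.finrank_pi_fintype,
    Finset.sum_const, Finset.card_univ, smul_eq_mul, Nat.card_eq_fintype_card]

/-- trace as a `K`-linear map -/
noncomputable def trL (n : ℕ) (K : Type*) [Field K] :
    Matrix (Fin n) (Fin n) (MvPolynomial (Sym2 (Fin n)) K) →ₗ[K] MvPolynomial (Sym2 (Fin n)) K :=
  Matrix.traceLinearMap (Fin n) K _

lemma trL_apply (M : Matrix (Fin n) (Fin n) (MvPolynomial (Sym2 (Fin n)) K)) :
    trL n K M = M.trace := rfl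

/-- left multiplication -/
noncomputable def mulL (Y : Matrix (Fin n) (Fin n) (MvPolynomial (Sym2 (Fin n)) K)) :
    Matrix (Fin n) (Fin n) (MvPolynomial (Sym2 (Fin n)) K) →ₗ[K]
      Matrix (Fin n) (Fin n) (MvPolynomial (Sym2 (Fin n)) K) := LinearMap.mulLeft K Y

lemma mulL_apply (Y M : Matrix (Fin n) (Fin n) (MvPolynomial (Sym2 (Fin n)) K)) :
    mulL Y M = Y * M := rfl

noncomputable def mulR (Y : Matrix (Fin n) (Fin n) (MvPolynomial (Sym2 (Fin n)) K)) :
    Matrix (Fin n) (Fin n) (MvPolynomial (Sym2 (Fin n)) K) →ₗ[K]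
      Matrix (Fin n) (Fin n) (MvPolynomial (Sym2 (Fin n)) K) := LinearMap.mulRight K Y

lemma mulR_apply (Y M : Matrix (Fin n) (Fin n) (MvPolynomial (Sym2 (Fin n)) K)) :
    mulR Y M = M * Y := rfl

lemma map_tr_W (hr : Equivalence r) (hn : 0 < n) (k : ℤ) :
    (W K r Q k).map (trL n K) = V K Q k := by
  ext p
  rw [Submodule.mem_map]
  constructor
  · rintro ⟨M, hM, rfl⟩
    rw [trL_apply]
    exact Submodule.sum_mem _ fun i _ => hM.2 i i
  · intro hp
    let a : Fin n := ⟨0, hn⟩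
    refine ⟨Matrix.single a a p, ⟨fun i j h => ?_, fun i j => ?_⟩, ?_⟩
    · rw [Matrix.single_apply, if_neg]
      rintro ⟨rfl, rfl⟩
      exact h (hr.refl _)
    · rw [Matrix.single_apply]
      split_ifs
      · exact hp
      · exact Submodule.zero_mem _
    · rw [trL_apply, Matrix.trace_single_eq_same]

/-- projection -/
noncomputable def pr (r : Fin n → Fin n → Prop) (Q : Set (Sym2 (Fin n))) (k : ℤ)
    (M : Matrix (Fin n) (Fin n) (MvPolynomial (Sym2 (Fin n)) K)) :
    Matrix (Fin n) (Fin n) (MvPolynomial (Sym2 (Fin n)) K) :=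
  blk r ((M.map (hc k)).map (rho K Q))

lemma pr_mem (k : ℤ) (M : Matrix (Fin n) (Fin n) (MvPolynomial (Sym2 (Fin n)) K)) :
    pr r Q k M ∈ W K r Q k := by
  refine ⟨blk_isBlk _, fun i j => ?_⟩
  unfold pr blk
  split_ifs
  · exact rho_hc_mem_V _ _ _
  · exact Submodule.zero_mem _

lemma pr_eq {k : ℤ} {M : Matrix (Fin n) (Fin n) (MvPolynomial (Sym2 (Fin n)) K)}
    (h : M ∈ W K r Q k) : pr r Q k M = M := by
  have h1 : (M.map (hc k)).map (rho K Q) = M := by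
    ext1 i j
    exact rho_hc_of_mem_V (h.2 i j)
  rw [pr, h1, h.1.blk_eq]

lemma pr_alt (hr : Equivalence r) {k : ℤ} {M : Matrix (Fin n) (Fin n) (MvPolynomial (Sym2 (Fin n)) K)}
    (h : Alt M) : Alt (pr r Q k M) := ((h.map (hc k)).map (rho K Q)).blk hr

lemma pr_sub {k : ℤ} (M N : Matrix (Fin n) (Fin n) (MvPolynomial (Sym2 (Fin n)) K)) :
    pr r Q k (M - N) = pr r Q k M - pr r Q k N := by
  unfold pr
  rw [← blk_sub]
  congr 1
  ext1 i j
  simp only [Matrix.map_apply, Matrix.sub_apply, map_sub]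

lemma pr_trace (hr : Equivalence r) {k : ℤ} (M : Matrix (Fin n) (Fin n) (MvPolynomial (Sym2 (Fin n)) K)) :
    (pr r Q k M).trace = rho K Q (hc k M.trace) := by
  rw [pr, trace_blk hr, ← trace_hc]
  simp only [Matrix.trace, Matrix.diag_apply, Matrix.map_apply, map_sum]

lemma rho_XQ : (XQ K Q).map (rho K Q) = XQ K Q := by
  ext1 i j
  rw [Matrix.map_apply, XQ_apply]
  split_ifs with h
  · rw [rho_X, if_pos h]
  · rw [map_zero]

lemma pr_mul (hr : Equivalence r) (hX : IsBlk r (XQ K Q)) {k : ℤ}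
    (B : Matrix (Fin n) (Fin n) (MvPolynomial (Sym2 (Fin n)) K)) :
    pr r Q (1 + k) (XQ K Q * B) = XQ K Q * pr r Q k B := by
  have h := hc_matmul (m := 1) (XQ_hom (K := K) Q) k B
  rw [Nat.cast_one] at h
  rw [pr, h, Matrix.map_mul, rho_XQ, blk_mul hr hX, pr]

lemma pr_mul' (hr : Equivalence r) (hX : IsBlk r (XQ K Q)) {k : ℤ}
    (B : Matrix (Fin n) (Fin n) (MvPolynomial (Sym2 (Fin n)) K)) :
    pr r Q (1 + k) (B * XQ K Q) = pr r Q k B * XQ K Q := by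
  have h := hc_matmul' (m := 1) (XQ_hom (K := K) Q) k B
  rw [Nat.cast_one] at h
  rw [pr, h, Matrix.map_mul, rho_XQ, blk_mul' hr hX, pr]

lemma mul_mem_W (hr : Equivalence r) (hX : IsBlk r (XQ K Q)) {k : ℤ}
    {B : Matrix (Fin n) (Fin n) (MvPolynomial (Sym2 (Fin n)) K)} (hB : B ∈ W K r Q k) :
    XQ K Q * B ∈ W K r Q (1 + k) := by
  rw [← pr_eq hB, ← pr_mul hr hX]; exact pr_mem _ _

lemma mul_mem_W' (hr : Equivalence r) (hX : IsBlk r (XQ K Q)) {k : ℤ}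
    {B : Matrix (Fin n) (Fin n) (MvPolynomial (Sym2 (Fin n)) K)} (hB : B ∈ W K r Q k) :
    B * XQ K Q ∈ W K r Q (1 + k) := by
  rw [← pr_eq hB, ← pr_mul' hr hX]; exact pr_mem _ _

/-- the map `M ↦ tr (adj X * M)` -/
noncomputable def eps (K : Type*) [Field K] (Q : Set (Sym2 (Fin n))) :
    Matrix (Fin n) (Fin n) (MvPolynomial (Sym2 (Fin n)) K) →ₗ[K] MvPolynomial (Sym2 (Fin n)) K :=
  trL n K ∘ₗ mulL (XQ K Q).adjugate

lemma eps_apply (M : Matrix (Fin n) (Fin n) (MvPolynomial (Sym2 (Fin n)) K)) :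
    eps K Q M = ((XQ K Q).adjugate * M).trace := rfl

lemma adj_symm : (XQ K Q).adjugate.IsSymm := by
  rw [Matrix.IsSymm, Matrix.adjugate_transpose, (XQ_symm Q).eq]

lemma sup_eq (hr : Equivalence r) (hX : IsBlk r (XQ K Q)) (h1 : E1 K r Q) (k : ℤ) :
    (W K r Q k ⊓ LinearMap.ker (trL n K)).map (mulL (XQ K Q)) ⊔ Al K r Q (1 + k) =
      W K r Q (1 + k) ⊓ LinearMap.ker (eps K Q) := by
  apply le_antisymm
  · apply sup_le
    · rintro _ ⟨B, ⟨hB, hB2⟩, rfl⟩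
      refine ⟨mul_mem_W hr hX hB, ?_⟩
      change eps K Q (XQ K Q * B) = 0
      rw [eps_apply, trace_adj_mul]
      have : B.trace = 0 := hB2
      rw [this, mul_zero]
    · intro A hA
      exact ⟨hA.1, by
        change eps K Q A = 0
        exact trace_mul_alt adj_symm hA.2⟩
  · rintro M ⟨hM, hM2⟩
    obtain ⟨B, hB, hA⟩ := h1 M hM.1 hM2
    have h3 := pr_alt (Q := Q) (k := 1 + k) hr hA
    rw [pr_sub, pr_eq hM, pr_mul hr hX] at h3
    rw [← add_sub_cancel (XQ K Q * pr r Q k B) M]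
    refine Submodule.add_mem_sup ⟨pr r Q k B, ⟨pr_mem _ _, ?_⟩, rfl⟩ ⟨?_, h3⟩
    · change (pr r Q k B).trace = 0
      rw [pr_trace hr, hB, map_zero, map_zero]
    · exact Submodule.sub_mem _ hM (mul_mem_W hr hX (pr_mem _ _))

lemma inf_eq (hr : Equivalence r) (hX : IsBlk r (XQ K Q)) (h2 : E2 K Q) (k : ℤ) :
    (W K r Q (1 + k) ⊓ LinearMap.ker (trL n K)).map (mulL (XQ K Q)) ⊓ Al K r Q (1 + (1 + k)) =
      (Al K r Q k).map (mulL (XQ K Q) ∘ₗ mulR (XQ K Q)) := by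
  apply le_antisymm
  · rintro _ ⟨⟨B, ⟨hB, hB2⟩, rfl⟩, hA⟩
    obtain ⟨A, hA1, hA2⟩ := h2 B hB2 hA.2
    refine ⟨pr r Q k A, ⟨pr_mem _ _, pr_alt hr hA1⟩, ?_⟩
    rw [LinearMap.comp_apply, mulR_apply, ← pr_mul' hr hX, ← hA2, pr_eq hB]
  · rintro _ ⟨A, hA, rfl⟩
    have h := mul_mem_W' hr hX hA.1
    exact ⟨⟨A * XQ K Q, ⟨h, trace_mul_XQ_alt hA.2⟩, rfl⟩, mul_mem_W hr hX h, alt_XAX hA.2⟩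

lemma finrank_map_inj {K M M' : Type*} [Field K] [AddCommGroup M] [Module K M] [AddCommGroup M']
    [Module K M'] (f : M →ₗ[K] M') (hf : Function.Injective f) (p : Submodule K M)
    [FiniteDimensional K p] :
    Module.finrank K (p.map f) = Module.finrank K p := by
  rw [← finrank_map_add f p, LinearMap.ker_eq_bot.2 hf, inf_bot_eq, finrank_bot, add_zero]

lemma finrank_E (hr : Equivalence r) (hn : 0 < n) (hX : IsBlk r (XQ K Q)) (hd : (XQ K Q).det ≠ 0)
    (h1 : E1 K r Q) (h2 : E2 K Q) (k : ℤ) (a b : ℕ)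
    (ha : Nat.card {p : Fin n × Fin n // r p.1 p.2} = a)
    (hb : Nat.card {p : Fin n × Fin n // p.1 < p.2 ∧ r p.1 p.2} = b) :
    (Module.finrank K ((W K r Q (1 + (1 + k))).map (eps K Q)) : ℤ) =
      a * Module.finrank K (V K Q (1 + (1 + k))) - (a - 1) * Module.finrank K (V K Q (1 + k))
        - b * (Module.finrank K (V K Q (1 + (1 + k))) - Module.finrank K (V K Q k)) := by
  have e1 := finrank_map_add (eps K Q) (W K r Q (1 + (1 + k)))
  have e2 := finrank_map_add (trL n K) (W K r Q (1 + k))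
  rw [← sup_eq hr hX h1] at e1
  rw [map_tr_W hr hn] at e2
  have iL : Function.Injective (mulL (XQ K Q)) := fun A B h => mul_right_inj_of_det hd h
  have iR : Function.Injective (mulR (XQ K Q)) := fun A B h => mul_left_inj_of_det hd h
  have : FiniteDimensional K (W K r Q (1 + k) ⊓ LinearMap.ker (trL n K) : Submodule K _) :=
    Submodule.finiteDimensional_of_le inf_le_left
  have e3 := Submodule.finrank_sup_add_finrank_inf_eq
    ((W K r Q (1 + k) ⊓ LinearMap.ker (trL n K)).map (mulL (XQ K Q))) (Al K r Q (1 + (1 + k)))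
  rw [inf_eq hr hX h2, finrank_map_inj _ iL,
    finrank_map_inj (mulL (XQ K Q) ∘ₗ mulR (XQ K Q)) (iL.comp iR)] at e3
  rw [finrank_Al hr, finrank_Al hr, hb] at e3
  rw [finrank_W, ha] at e1 e2
  zify at e1 e2 e3
  linarith

end count
end SMin


namespace SMin

section minors
variable {m : ℕ} {R : Type*} [CommRing R]

lemma adj_mem_minors (Y : Matrix (Fin (m + 1)) (Fin (m + 1)) R) (i j : Fin (m + 1)) :
    Y.adjugate i j ∈ minorsIdeal m Y := by
  rw [Matrix.adjugate_fin_succ_eq_det_submatrix]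
  exact Ideal.mul_mem_left _ _ (Ideal.subset_span
    ⟨_, _, Fin.succAbove_right_injective, Fin.succAbove_right_injective, rfl⟩)

lemma inj_factor {f : Fin m → Fin (m + 1)} (hf : Function.Injective f) :
    ∃ (a : Fin (m + 1)) (s : Equiv.Perm (Fin m)), f = a.succAbove ∘ s := by
  have h1 : ∃ a, a ∉ Set.range f := by
    by_contra! h
    have := Fintype.card_le_of_surjective f fun x => h x
    simp at this
  obtain ⟨a, ha⟩ := h1
  have h2 : ∀ x, ∃ y, a.succAbove y = f x := fun x =>
    Fin.exists_succAbove_eq fun h => ha ⟨x, h⟩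
  choose s hs using h2
  have hi : Function.Injective s := fun x y h => hf (by rw [← hs, ← hs, h])
  refine ⟨a, Equiv.ofBijective s (Finite.injective_iff_bijective.1 hi), ?_⟩
  funext x
  exact (hs x).symm

lemma minors_mul_adj (Y : Matrix (Fin (m + 1)) (Fin (m + 1)) R) {f g : Fin m → Fin (m + 1)}
    (hf : Function.Injective f) (hg : Function.Injective g) :
    ∃ (c : R) (i j : Fin (m + 1)), (Y.submatrix f g).det = Y.adjugate i j * c := by
  obtain ⟨a, s, rfl⟩ := inj_factor hf
  obtain ⟨b, t, rfl⟩ := inj_factor hg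
  have h : Y.submatrix (a.succAbove ∘ s) (b.succAbove ∘ t) =
      ((Y.submatrix a.succAbove b.succAbove).submatrix s id).submatrix id t := rfl
  rw [h, Matrix.det_permute', Matrix.det_permute]
  have h2 := Matrix.adjugate_fin_succ_eq_det_submatrix Y b a
  have h3 : (-1 : R) ^ ((a : ℕ) + b) * (-1) ^ ((a : ℕ) + b) = 1 := by
    rw [← mul_pow]; simp
  refine ⟨(-1) ^ ((a : ℕ) + b) * ((Equiv.Perm.sign t : ℤ) : R) * ((Equiv.Perm.sign s : ℤ) : R), b, a, ?_⟩
  rw [h2]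
  calc _ = ((-1 : R) ^ ((a : ℕ) + b) * (-1) ^ ((a : ℕ) + b)) * (((Equiv.Perm.sign t : ℤ) : R) * (((Equiv.Perm.sign s : ℤ) : R) * (Y.submatrix a.succAbove b.succAbove).det)) := by
        rw [h3, one_mul]
    _ = _ := by ring

lemma minors_eps (Y : Matrix (Fin (m + 1)) (Fin (m + 1)) R) {q : R} (h : q ∈ minorsIdeal m Y) :
    ∃ C : Matrix (Fin (m + 1)) (Fin (m + 1)) R, q = (Y.adjugate * C).trace := by
  refine Submodule.span_induction (p := fun q _ => ∃ C : Matrix (Fin (m + 1)) (Fin (m + 1)) R,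
    q = (Y.adjugate * C).trace) ?_ ?_ ?_ ?_ h
  · rintro _ ⟨f, g, hf, hg, rfl⟩
    obtain ⟨c, i, j, h⟩ := minors_mul_adj Y hf hg
    refine ⟨Matrix.single j i c, ?_⟩
    rw [h, Matrix.trace_mul_single]
    simp
  · exact ⟨0, by simp⟩
  · rintro _ _ _ _ ⟨C, rfl⟩ ⟨D, rfl⟩
    exact ⟨C + D, by rw [Matrix.mul_add, Matrix.trace_add]⟩
  · rintro a _ _ ⟨C, rfl⟩
    exact ⟨a • C, by rw [Matrix.mul_smul, Matrix.trace_smul]⟩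

lemma eps_minors (Y C : Matrix (Fin (m + 1)) (Fin (m + 1)) R) :
    (Y.adjugate * C).trace ∈ minorsIdeal m Y := by
  refine Ideal.sum_mem _ fun i _ => ?_
  rw [Matrix.diag_apply, Matrix.mul_apply]
  exact Ideal.sum_mem _ fun j _ => Ideal.mul_mem_right _ _ (adj_mem_minors _ _ _)

end minors

section quot
variable {n : ℕ} {K : Type*} [Field K]

lemma sparse_eq (G : SimpleGraph (Fin n)) :
    sparseGenericSym K n G = XQ K (dg n ∪ G.edgeSet) := by
  ext1 i j
  rw [XQ_apply, sparseGenericSym, Set.mem_union, mem_dg, SimpleGraph.mem_edgeSet]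
  congr

/-- the ideal generated by variables outside `Q` -/
noncomputable def ZI (K : Type*) [Field K] (Q : Set (Sym2 (Fin n))) :
    Ideal (MvPolynomial (Sym2 (Fin n)) K) := Ideal.span {f | ∃ e, e ∉ Q ∧ f = X e}

variable {Q : Set (Sym2 (Fin n))} {r : Fin n → Fin n → Prop}

lemma sub_rho_mem (p : MvPolynomial (Sym2 (Fin n)) K) : p - rho K Q p ∈ ZI K Q := by
  have h : ((Ideal.Quotient.mkₐ K (ZI K Q)).comp (rho K Q)) = Ideal.Quotient.mkₐ K (ZI K Q) := by
    apply MvPolynomial.algHom_ext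
    intro e
    rw [AlgHom.comp_apply, rho_X]
    split_ifs with h
    · rfl
    · rw [map_zero]
      exact (Ideal.Quotient.eq_zero_iff_mem.2 (show X e ∈ ZI K Q from Ideal.subset_span ⟨e, h, rfl⟩)).symm
  rw [← Ideal.Quotient.eq]
  exact (DFunLike.congr_fun h p).symm

lemma rho_ZI {p : MvPolynomial (Sym2 (Fin n)) K} (h : p ∈ ZI K Q) : rho K Q p = 0 := by
  have : ZI K Q ≤ RingHom.ker (rho K Q) := by
    rw [ZI, Ideal.span_le]
    rintro _ ⟨e, he, rfl⟩
    change rho K Q (X e) = 0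
    rw [rho_X, if_neg he]
  exact this h

lemma rho_adj : (XQ K Q).adjugate.map (rho K Q) = (XQ K Q).adjugate := by
  have h := RingHom.map_adjugate (rho K Q).toRingHom (XQ K Q)
  have h2 : (rho K Q).toRingHom.mapMatrix (XQ K Q) = XQ K Q := rho_XQ
  rw [h2] at h
  exact h

lemma pr_adj (hr : Equivalence r) (hX : IsBlk r (XQ K Q)) (hd : (XQ K Q).det ≠ 0) {k : ℤ}
    (B : Matrix (Fin n) (Fin n) (MvPolynomial (Sym2 (Fin n)) K)) :
    pr r Q (((n - 1 : ℕ) : ℤ) + k) ((XQ K Q).adjugate * B) = (XQ K Q).adjugate * pr r Q k B := by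
  have h := hc_matmul (m := n - 1) (adj_hom (XQ_hom (K := K) Q)) k B
  rw [pr, h, Matrix.map_mul, rho_adj, blk_mul hr (adjugate_isBlk hr hX hd), pr]

lemma eps_pr (hr : Equivalence r) (hX : IsBlk r (XQ K Q)) (hd : (XQ K Q).det ≠ 0) {k : ℤ}
    (B : Matrix (Fin n) (Fin n) (MvPolynomial (Sym2 (Fin n)) K)) :
    eps K Q (pr r Q k B) = rho K Q (hc (((n - 1 : ℕ) : ℤ) + k) (eps K Q B)) := by
  rw [eps_apply, ← pr_adj hr hX hd, pr_trace hr]; rfl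

instance finS (d : ℕ) : FiniteDimensional K (homogeneousSubmodule (Sym2 (Fin n)) K d) := by
  have h : homogeneousSubmodule (Sym2 (Fin n)) K d = V K Set.univ d := by
    ext p
    rw [mem_V, gr_nat]
    refine ⟨fun h => ⟨h, ?_⟩, fun h => h.1⟩
    ext s
    rw [coeff_rho, if_pos (Set.subset_univ _)]
  rw [h]
  infer_instance

lemma map_rho_S (d : ℕ) : (homogeneousSubmodule (Sym2 (Fin n)) K d).map (rho K Q).toLinearMap
    = V K Q d := by
  ext p
  rw [Submodule.mem_map]
  constructor
  · rintro ⟨q, hq, rfl⟩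
    rw [← gr_nat] at hq
    exact rho_gr_mem_V hq
  · intro hp
    have := (mem_V.1 hp).1
    rw [gr_nat] at this
    exact ⟨p, this, (mem_V.1 hp).2⟩

lemma qdim (hr : Equivalence r) (hn : 0 < n) (hX : IsBlk r (XQ K Q)) (hd : (XQ K Q).det ≠ 0) (d : ℕ) :
    (quotientComponentDim K (minorsIdeal (n - 1) (XQ K Q) ⊔ ZI K Q) d : ℤ) =
      Module.finrank K (V K Q d) -
        Module.finrank K ((W K r Q (d - (n - 1 : ℕ))).map (eps K Q)) := by
  obtain ⟨m, rfl⟩ : ∃ m, n = m + 1 := ⟨n - 1, by omega⟩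
  set J := minorsIdeal (m + 1 - 1) (XQ K Q) ⊔ ZI K Q with hJ
  set S := homogeneousSubmodule (Sym2 (Fin (m + 1))) K d with hS
  set P : Submodule K (MvPolynomial (Sym2 (Fin (m + 1))) K) := Submodule.restrictScalars K J ⊓ S with hP
  have hPS : P ≤ S := inf_le_right
  have : FiniteDimensional K P := Submodule.finiteDimensional_of_le hPS
  have e1 := Submodule.finrank_quotient_add_finrank (P.comap S.subtype)
  rw [(Submodule.comapSubtypeEquivOfLe hPS).finrank_eq] at e1
  have e2 := finrank_map_add (rho K Q).toLinearMap S
  have e3 := finrank_map_add (rho K Q).toLinearMap P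
  have hk : P ⊓ LinearMap.ker (rho K Q).toLinearMap = S ⊓ LinearMap.ker (rho K Q).toLinearMap := by
    apply le_antisymm (inf_le_inf_right _ hPS)
    rintro p ⟨hp, hp2⟩
    refine ⟨⟨?_, hp⟩, hp2⟩
    have h1 := sub_rho_mem (Q := Q) p
    have h2 : rho K Q p = 0 := hp2
    rw [h2, sub_zero] at h1
    exact Submodule.mem_sup_right h1
  have hE : P.map (rho K Q).toLinearMap = (W K r Q (d - (m + 1 - 1 : ℕ))).map (eps K Q) := by
    have hdeg : ((m + 1 - 1 : ℕ) : ℤ) + (d - (m + 1 - 1 : ℕ)) = d := by ring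
    apply le_antisymm
    · rintro _ ⟨p, ⟨hp, hp2⟩, rfl⟩
      obtain ⟨q, hq, z, hz, hqz⟩ := Submodule.mem_sup.1 hp
      obtain ⟨C, hC⟩ := minors_eps _ hq
      refine ⟨pr r Q (d - (m + 1 - 1 : ℕ)) C, pr_mem _ _, ?_⟩
      rw [eps_pr hr hX hd, hdeg]
      change _ = rho K Q p
      have hp3 : p ∈ gr _ K (d : ℤ) := by rw [gr_nat]; exact hp2
      rw [eps_apply, ← hC]
      conv_rhs => rw [← hc_of_mem hp3, ← hqz, map_add, map_add, rho_hc _ _ z, rho_ZI hz, map_zero, add_zero]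
    · rintro _ ⟨M, hM, rfl⟩
      have h1 := eps_pr hr hX hd (k := d - (m + 1 - 1 : ℕ)) M
      rw [hdeg, pr_eq hM] at h1
      have h2 : eps K Q M ∈ V K Q d := by
        rw [h1]; exact rho_hc_mem_V _ _ _
      have h3 := (mem_V.1 h2).1
      rw [gr_nat] at h3
      exact ⟨eps K Q M, ⟨Submodule.mem_sup_left (eps_minors _ M), h3⟩, (mem_V.1 h2).2⟩
  rw [hS, map_rho_S] at e2
  rw [hk, hE] at e3
  have e0 : quotientComponentDim K J d = Module.finrank K (S ⧸ P.comap S.subtype) := rfl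
  rw [e0]
  rw [hS] at *
  zify at e1 e2 e3
  linarith

end quot
end SMin


namespace SMin

lemma card_pairs {n : ℕ} {r : Fin n → Fin n → Prop} (hr : Equivalence r) :
    Nat.card {p : Fin n × Fin n // r p.1 p.2} =
      n + 2 * Nat.card {p : Fin n × Fin n // p.1 < p.2 ∧ r p.1 p.2} := by
  rw [Nat.card_eq_fintype_card, Nat.card_eq_fintype_card, Fintype.card_subtype, Fintype.card_subtype]
  have h1 : (Finset.univ.filter fun p : Fin n × Fin n => r p.1 p.2) =
      (Finset.univ.filter fun p : Fin n × Fin n => p.1 = p.2) ∪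
      ((Finset.univ.filter fun p : Fin n × Fin n => p.1 < p.2 ∧ r p.1 p.2) ∪
      (Finset.univ.filter fun p : Fin n × Fin n => p.2 < p.1 ∧ r p.1 p.2)) := by
    ext ⟨i, j⟩
    simp only [Finset.mem_filter, Finset.mem_univ, true_and, Finset.mem_union]
    constructor
    · intro h
      rcases lt_trichotomy i j with h' | h' | h'
      · exact Or.inr (Or.inl ⟨h', h⟩)
      · exact Or.inl h'
      · exact Or.inr (Or.inr ⟨h', h⟩)
    · rintro (rfl | h | h)
      · exact hr.refl _
      · exact h.2
      · exact h.2
  have h2 : (Finset.univ.filter fun p : Fin n × Fin n => p.2 < p.1 ∧ r p.1 p.2).card =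
      (Finset.univ.filter fun p : Fin n × Fin n => p.1 < p.2 ∧ r p.1 p.2).card := by
    refine Finset.card_bij' (fun p _ => p.swap) (fun p _ => p.swap) ?_ ?_ ?_ ?_
    · rintro ⟨i, j⟩ h
      simp only [Finset.mem_filter, Finset.mem_univ, true_and, Prod.swap] at h ⊢
      exact ⟨h.1, hr.symm h.2⟩
    · rintro ⟨i, j⟩ h
      simp only [Finset.mem_filter, Finset.mem_univ, true_and, Prod.swap] at h ⊢
      exact ⟨h.1, hr.symm h.2⟩
    · intros; rfl
    · intros; rfl
  have h3 : (Finset.univ.filter fun p : Fin n × Fin n => p.1 = p.2).card = n := by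
    have : (Finset.univ.filter fun p : Fin n × Fin n => p.1 = p.2) =
        (Finset.univ : Finset (Fin n)).diag := by
      ext ⟨i, j⟩; simp
    rw [this, Finset.diag_card, Finset.card_univ, Fintype.card_fin]
  rw [h1, Finset.card_union_of_disjoint, Finset.card_union_of_disjoint, h2, h3]
  · ring
  · rw [Finset.disjoint_left]
    rintro ⟨i, j⟩ h h'
    simp only [Finset.mem_filter, Finset.mem_univ, true_and] at h h'
    exact lt_asymm h.1 h'.1
  · rw [Finset.disjoint_left]
    rintro ⟨i, j⟩ h h'
    simp only [Finset.mem_filter, Finset.mem_univ, true_and, Finset.mem_union] at h h'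
    rcases h' with h' | h'
    · exact absurd h'.1 (by rw [h]; exact lt_irrefl _)
    · exact absurd h'.1 (by rw [h]; exact lt_irrefl _)

lemma card_lt (n : ℕ) (r : Fin n → Fin n → Prop) :
    Nat.card {p : Fin n × Fin n // p.1 < p.2 ∧ r p.1 p.2} +
      Nat.card {p : Fin n × Fin n // p.1 < p.2 ∧ ¬ r p.1 p.2} = n.choose 2 := by
  have h1 := card_pairs (n := n) (r := fun _ _ => True) ⟨fun _ => trivial, fun _ => trivial, fun _ _ => trivial⟩
  have h2 : Nat.card {p : Fin n × Fin n // True} = n * n := by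
    rw [Nat.card_eq_fintype_card, Fintype.card_subtype]
    simp
  rw [h2] at h1
  have h3 : Nat.card {p : Fin n × Fin n // p.1 < p.2 ∧ True} =
      Nat.card {p : Fin n × Fin n // p.1 < p.2 ∧ r p.1 p.2} +
      Nat.card {p : Fin n × Fin n // p.1 < p.2 ∧ ¬ r p.1 p.2} := by
    rw [Nat.card_eq_fintype_card, Nat.card_eq_fintype_card, Nat.card_eq_fintype_card,
      Fintype.card_subtype, Fintype.card_subtype, Fintype.card_subtype]
    simp only [and_true]
    rw [← Finset.filter_filter, ← Finset.filter_filter, Finset.card_filter_add_card_filter_not]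
  rw [← h3, Nat.choose_two_right, Nat.mul_sub, mul_one]
  omega

lemma card_Q {n : ℕ} (G : SimpleGraph (Fin n)) :
    Nat.card (dg n ∪ G.edgeSet : Set (Sym2 (Fin n))) = n + Nat.card G.edgeSet := by
  rw [Nat.card_coe_set_eq, Nat.card_coe_set_eq, Set.ncard_union_eq]
  · congr 1
    have : dg n = Set.range (Sym2.diag : Fin n → Sym2 (Fin n)) := by
      ext e
      rw [Set.mem_range]
      exact ⟨fun h => by
        induction e using Sym2.ind with
        | _ i j => exact ⟨i, by rw [(mem_dg i j).1 h]; rfl⟩, fun ⟨a, h⟩ => by rw [← h]; exact Sym2.diag_isDiag a⟩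
    rw [this, ← Set.image_univ, Set.ncard_image_of_injective _ Sym2.diag_injective, Set.ncard_univ,
      Nat.card_eq_fintype_card, Fintype.card_fin]
  · rw [Set.disjoint_left]
    exact fun e h h' => G.not_isDiag_of_mem_edgeSet h' h

lemma isBlk_graph {n : ℕ} {K : Type*} [Field K] (G : SimpleGraph (Fin n)) :
    IsBlk G.Reachable (XQ K (dg n ∪ G.edgeSet)) := by
  intro i j h
  rw [XQ_apply, if_neg]
  rw [Set.mem_union, mem_dg, SimpleGraph.mem_edgeSet]
  rintro (rfl | h')
  · exact h (SimpleGraph.Reachable.refl _)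
  · exact h h'.reachable

end SMin

/-- The Hilbert function of `R_G/(I_{n-1}(X_G)·R_G)`, where `R_G = R/(Z)` is the polynomial
ring in `N_G = n + |E(G)|` variables (so that `R_G/(I_{n-1}(X_G)·R_G) = R/(I_{n-1}(X_G) + (Z))`):
for every `d ≥ 0` the `K`-dimension of the degree-`d` homogeneous component equals
`C(d+N_G−1, N_G−1) − (C(n+1,2) − D_G)·C(d−n+N_G, N_G−1) + (n²−1−2D_G)·C(d−n+N_G−1, N_G−1)
  − (C(n,2) − D_G)·C(d−n+N_G−2, N_G−1)`. -/
theorem hilbertFunction_quotient_submaximalMinors_sparse_symmetric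
    (K : Type*) [Field K] (n : ℕ) (hn : 2 ≤ n) (G : SimpleGraph (Fin n)) (d : ℕ) :
    (quotientComponentDim K
        (minorsIdeal (n - 1) (sparseGenericSym K n G) ⊔
          Ideal.span {f : SymPolyRing K n |
            ∃ e : Sym2 (Fin n), ¬ e.IsDiag ∧ e ∉ G.edgeSet ∧ f = MvPolynomial.X e}) d : ℤ) =
      (let N : ℤ := (n : ℤ) + Nat.card G.edgeSet;
        intChoose ((d : ℤ) + N - 1) (N - 1)
          - ((Nat.choose (n + 1) 2 : ℤ) - DG G) * intChoose ((d : ℤ) - n + N) (N - 1)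
          + ((n : ℤ) ^ 2 - 1 - 2 * DG G) * intChoose ((d : ℤ) - n + N - 1) (N - 1)
          - ((Nat.choose n 2 : ℤ) - DG G) * intChoose ((d : ℤ) - n + N - 2) (N - 1)) := by
  have hr : Equivalence G.Reachable := G.reachable_is_equivalence
  have hd : (SMin.XQ K (SMin.dg n ∪ G.edgeSet)).det ≠ 0 := SMin.det_XQ Set.subset_union_left
  have hZ : Ideal.span {f : SymPolyRing K n |
      ∃ e : Sym2 (Fin n), ¬ e.IsDiag ∧ e ∉ G.edgeSet ∧ f = MvPolynomial.X e} =
      SMin.ZI K (SMin.dg n ∪ G.edgeSet) := by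
    rw [SMin.ZI]
    congr 1
    ext f
    constructor
    · rintro ⟨e, h1, h2, h3⟩
      exact ⟨e, fun h => h.elim h1 h2, h3⟩
    · rintro ⟨e, h1, h3⟩
      exact ⟨e, fun h => h1 (Or.inl h), fun h => h1 (Or.inr h), h3⟩
  obtain ⟨b, hb⟩ : ∃ b, Nat.card {p : Fin n × Fin n // p.1 < p.2 ∧ G.Reachable p.1 p.2} = b :=
    ⟨_, rfl⟩
  have ha := SMin.card_pairs hr
  have hl := SMin.card_lt n G.Reachable
  have hD : Nat.card {p : Fin n × Fin n // p.1 < p.2 ∧ ¬ G.Reachable p.1 p.2} = DG G := rfl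
  rw [hD, hb] at hl
  rw [hb] at ha
  have hE := SMin.finrank_E (K := K) hr (by omega) (SMin.isBlk_graph G) hd (SMin.E1_graph G)
    (SMin.E2_graph G) ((d : ℤ) - n - 1) _ _ ha hb
  rw [show (1 + (1 + ((d : ℤ) - n - 1))) = d - (n - 1 : ℕ) by omega,
    show (1 + ((d : ℤ) - n - 1)) = d - n by ring] at hE
  have hN := SMin.card_Q G
  have hV := SMin.finrank_V (K := K) _ _ hN (by omega)
  rw [hZ, SMin.sparse_eq, SMin.qdim hr (by omega) (SMin.isBlk_graph G) hd, hE, hV, hV, hV, hV]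
  dsimp only
  have c1 : (((n + 1).choose 2 : ℕ) : ℤ) = n + n.choose 2 := by
    rw [Nat.choose_succ_succ' n 1, Nat.choose_one_right]; push_cast; rfl
  have c2 : (n : ℤ) ^ 2 = n + 2 * (n.choose 2 : ℕ) := by
    have h2 : n * n = n + 2 * n.choose 2 := by
      rw [Nat.choose_two_right, Nat.mul_div_cancel' (Nat.even_mul_pred_self n).two_dvd,
        Nat.mul_sub, mul_one, Nat.add_sub_cancel' (Nat.le_mul_self n)]
    rw [pow_two]; exact_mod_cast h2
  have c3 : ((n.choose 2 : ℕ) : ℤ) = b + DG G := by exact_mod_cast hl.symm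
  rw [c1, c2, c3]
  push_cast
  rw [show (d : ℤ) - ((n - 1 : ℕ) : ℤ) + (n + (Nat.card G.edgeSet : ℤ)) - 1 =
      d - n + (n + (Nat.card G.edgeSet : ℤ)) by omega,
    show (d : ℤ) - n - 1 + (n + (Nat.card G.edgeSet : ℤ)) - 1 =
      d - n + (n + (Nat.card G.edgeSet : ℤ)) - 2 by ring]
  ring
end

section
/- Let I ⊆ R be the squarefree monomial ideal generated by the n monomials (x_{11}⋯x_{nn})/x_{ii} for i = 1,…,n together with the C(n,2) monomials (x_{11}⋯x_{nn})/(x_{kk}·x_{ll})·x_{kl} for 1 ≤ k < l ≤ n. Then I and I_{n-1}(X) have the same Hilbert function: for every integer d ≥ 0, the K-dimension of the degree-d homogeneous component of I equals the K-dimension of the degree-d homogeneous component of I_{n-1}(X). -/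
open MvPolynomial
open scoped Classical

/-- The generic symmetric `n × n` matrix `X = (x_{ij})`. -/
noncomputable def genericSym (K : Type*) [Field K] (n : ℕ) :
    Matrix (Fin n) (Fin n) (SymPolyRing K n) :=
  fun i j => MvPolynomial.X s(i, j)

/-- The dimension over `K` of the degree-`d` homogeneous component of an ideal `J` of
`MvPolynomial σ K`, i.e. of the `K`-subspace of homogeneous polynomials of degree `d`
lying in `J`. -/
noncomputable def idealComponentDim (K : Type*) [Field K] {σ : Type*}
    (J : Ideal (MvPolynomial σ K)) (d : ℕ) : ℕ :=
  Module.finrank K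
    ↥(Submodule.restrictScalars K J ⊓ homogeneousSubmodule σ K d)

namespace SymHilb

variable {K : Type*} [Field K] {n : ℕ}

/-- exponent of the leading monomial -/
noncomputable def mexp (i k : Fin n) : Sym2 (Fin n) →₀ ℕ :=
  if i = k then ∑ j ∈ Finset.univ.erase i, Finsupp.single s(j, j) 1
  else ∑ j ∈ (Finset.univ.erase i).erase k, Finsupp.single s(j, j) 1 + Finsupp.single s(i, k) 1

/-- diagonal weight -/
noncomputable def wt (u : Sym2 (Fin n) →₀ ℕ) : ℕ := ∑ j, u s(j, j)

lemma wt_add (u v : Sym2 (Fin n) →₀ ℕ) : wt (u + v) = wt u + wt v := by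
  simp [wt, Finset.sum_add_distrib]

lemma wt_sum {ι : Type*} (s : Finset ι) (f : ι → Sym2 (Fin n) →₀ ℕ) :
    wt (∑ a ∈ s, f a) = ∑ a ∈ s, wt (f a) := by
  simp only [wt, Finsupp.finsetSum_apply]
  exact Finset.sum_comm

lemma wt_single (a b : Fin n) :
    wt (Finsupp.single s(a, b) 1) = if a = b then 1 else 0 := by
  unfold wt
  split_ifs with h
  · subst h
    rw [Finset.sum_eq_single a]
    · simp
    · intro c _ hc
      rw [Finsupp.single_apply, if_neg]
      simp only [Sym2.eq_iff]; tauto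
    · simp
  · apply Finset.sum_eq_zero
    intro c _
    rw [Finsupp.single_apply, if_neg]
    simp only [Sym2.eq_iff]
    rintro (⟨rfl, rfl⟩ | ⟨rfl, rfl⟩) <;> exact h rfl

lemma mexp_symm (i k : Fin n) : mexp i k = mexp k i := by
  unfold mexp
  by_cases h : i = k
  · subst h; rfl
  · rw [if_neg h, if_neg (Ne.symm h), Finset.erase_right_comm, Sym2.eq_swap]

lemma mexp_diag_add (i : Fin n) :
    mexp i i + Finsupp.single s(i, i) 1 = ∑ j : Fin n, Finsupp.single s(j, j) 1 := by
  unfold mexp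
  rw [if_pos rfl, Finset.sum_erase_add _ _ (Finset.mem_univ i)]

lemma mexp_add (i k : Fin n) (h : i ≠ k) :
    mexp i k + Finsupp.single s(k, k) 1 = mexp i i + Finsupp.single s(i, k) 1 := by
  have : k ∈ Finset.univ.erase i := by simp [Ne.symm h]
  unfold mexp
  rw [if_pos rfl, if_neg h, ← Finset.sum_erase_add _ _ this]
  abel

lemma wt_mexp_self (i : Fin n) : wt (mexp i i) = n - 1 := by
  unfold mexp
  rw [if_pos rfl, wt_sum]
  simp [wt_single]

lemma wt_mexp_ne (i k : Fin n) (h : i ≠ k) : wt (mexp i k) + 2 = n := by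
  have h1 := congrArg wt (mexp_add i k h)
  have h2 := congrArg wt (mexp_diag_add i)
  rw [wt_add, wt_add, wt_single, wt_single, if_pos rfl, if_neg h] at h1
  rw [wt_add, wt_single, if_pos rfl, wt_sum] at h2
  simp [wt_single] at h2
  omega

lemma degree_mexp (i k : Fin n) : (mexp i k).degree = n - 1 := by
  have h2 := congrArg Finsupp.degree (mexp_diag_add i)
  have e : (∑ j : Fin n, Finsupp.single s(j, j) 1 : Sym2 (Fin n) →₀ ℕ).degree = n := by
    simp [map_sum, Finsupp.degree_single]
  rw [e, map_add, Finsupp.degree_single] at h2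
  by_cases h : i = k
  · subst h; omega
  · have h1 := congrArg Finsupp.degree (mexp_add i k h)
    simp only [map_add, Finsupp.degree_single] at h1
    omega

/-- signed minors -/
noncomputable def G (K : Type*) [Field K] (i k : Fin n) : SymPolyRing K n :=
  if i = k then (genericSym K n).adjugate i k else - (genericSym K n).adjugate i k

lemma genericSym_transpose : (genericSym K n).transpose = genericSym K n := by
  ext1 i j
  simp [genericSym, Sym2.eq_swap]

lemma adj_symm (i k : Fin n) :
    (genericSym K n).adjugate i k = (genericSym K n).adjugate k i := by
  conv_rhs => rw [← genericSym_transpose, ← Matrix.adjugate_transpose, Matrix.transpose_apply]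

lemma G_symm (i k : Fin n) : G K i k = G K k i := by
  unfold G
  by_cases h : i = k
  · subst h; rfl
  · rw [if_neg h, if_neg (Ne.symm h), adj_symm]

/-- The exponent attached to a permutation. -/
noncomputable def pexp (σ : Equiv.Perm (Fin n)) (i : Fin n) : Sym2 (Fin n) →₀ ℕ :=
  ∑ a ∈ Finset.univ.erase i, Finsupp.single s(σ a, a) 1

lemma adj_eq (i k : Fin n) : (genericSym K n).adjugate i k =
    ∑ σ : Equiv.Perm (Fin n), if σ i = k then
      Equiv.Perm.sign σ • (monomial (pexp σ i) (1 : K)) else 0 := by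
  rw [Matrix.adjugate_apply, Matrix.det_apply]
  refine Finset.sum_congr rfl fun σ _ => ?_
  rw [← Finset.mul_prod_erase _ _ (Finset.mem_univ i)]
  split_ifs with h
  · congr 1
    rw [h]
    simp only [Matrix.updateRow_self, Pi.single_eq_same, one_mul]
    rw [pexp, MvPolynomial.monomial_sum_one]
    refine Finset.prod_congr rfl fun a ha => ?_
    rw [Matrix.updateRow_ne]
    · rfl
    · rw [← h]; intro e; exact (Finset.ne_of_mem_erase ha) (σ.injective e)
  · by_cases h' : ∃ a, a ≠ i ∧ σ a = k
    · obtain ⟨a, ha, hk⟩ := h'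
      rw [Finset.prod_eq_zero (i := a) (by simp [ha])]
      · simp
      · rw [hk, Matrix.updateRow_self, Pi.single_eq_of_ne ha]
    · exfalso
      obtain ⟨a, rfl⟩ := σ.surjective k
      apply h'
      exact ⟨a, fun e => h (by rw [e]), rfl⟩

lemma degree_pexp (σ : Equiv.Perm (Fin n)) (i : Fin n) : (pexp σ i).degree = n - 1 := by
  simp [pexp, map_sum, Finsupp.degree_single]

lemma wt_pexp (σ : Equiv.Perm (Fin n)) (i : Fin n) :
    wt (pexp σ i) = ((Finset.univ.erase i).filter fun a => σ a = a).card := by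
  rw [pexp, wt_sum]
  simp only [wt_single, Finset.card_filter]

lemma homog_adj (i k : Fin n) : ((genericSym K n).adjugate i k).IsHomogeneous (n - 1) := by
  rw [adj_eq]
  apply IsHomogeneous.sum
  intro σ _
  split_ifs
  · have : (monomial (pexp σ i) (1 : K)).IsHomogeneous (n - 1) :=
      isHomogeneous_monomial _ (degree_pexp σ i)
    rcases Int.units_eq_one_or (Equiv.Perm.sign σ) with h | h <;> rw [h]
    · simpa using this
    · simpa using this.neg
  · exact isHomogeneous_zero _ _ _

lemma homog_G (i k : Fin n) : (G K i k).IsHomogeneous (n - 1) := by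
  unfold G
  split_ifs
  · exact homog_adj i k
  · exact (homog_adj i k).neg

/-- polynomials of diagonal weight less than `N` -/
noncomputable def F (K : Type*) [Field K] (n N : ℕ) : Submodule K (SymPolyRing K n) :=
  Submodule.span K ((fun u => monomial u (1 : K)) '' {u | wt u < N})

lemma mem_F_monomial {N : ℕ} (u : Sym2 (Fin n) →₀ ℕ) (c : K) (h : wt u < N) :
    monomial u c ∈ F K n N := by
  have : monomial u c = c • monomial u (1 : K) := by simp [smul_monomial]
  rw [this]
  exact Submodule.smul_mem _ _ (Submodule.subset_span ⟨u, h, rfl⟩)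

lemma F_mul (v : Sym2 (Fin n) →₀ ℕ) {N : ℕ} {p : SymPolyRing K n} (hp : p ∈ F K n N) :
    monomial v 1 * p ∈ F K n (wt v + N) := by
  induction hp using Submodule.span_induction with
  | mem x h =>
    obtain ⟨u, hu, rfl⟩ := h
    simp only [monomial_mul, mul_one]
    apply mem_F_monomial
    rw [wt_add]
    have : wt u < N := hu
    omega
  | zero => simp
  | add x y _ _ hx hy => rw [mul_add]; exact add_mem hx hy
  | smul a x _ hx => rw [mul_smul_comm]; exact Submodule.smul_mem _ _ hx

lemma F_zero {p : SymPolyRing K n} (hp : p ∈ F K n 0) : p = 0 := by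
  simpa [F] using hp

lemma F_mono {M N : ℕ} (h : M ≤ N) : F K n M ≤ F K n N := by
  apply Submodule.span_mono
  apply Set.image_mono
  intro u (hu : wt u < M)
  exact lt_of_lt_of_le hu h

lemma exists_F (p : SymPolyRing K n) : ∃ N, p ∈ F K n N := by
  induction p using MvPolynomial.induction_on' with
  | monomial u a => exact ⟨wt u + 1, mem_F_monomial _ _ (Nat.lt_succ_self _)⟩
  | add p q hp hq =>
    obtain ⟨a, ha⟩ := hp
    obtain ⟨b, hb⟩ := hq
    exact ⟨max a b, add_mem (F_mono (le_max_left _ _) ha) (F_mono (le_max_right _ _) hb)⟩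

lemma sign_smul_mem {N : ℕ} {p : SymPolyRing K n} (e : ℤˣ) (hp : p ∈ F K n N) :
    e • p ∈ F K n N := by
  rcases Int.units_eq_one_or e with h | h <;> rw [h]
  · simpa using hp
  · simpa using hp

lemma lead_aux (i k : Fin n) (τ : Equiv.Perm (Fin n)) (hτ : τ i = k)
    (N : ℕ) (h : ∀ σ : Equiv.Perm (Fin n), σ i = k → σ ≠ τ → wt (pexp σ i) < N) :
    (genericSym K n).adjugate i k - Equiv.Perm.sign τ • (monomial (pexp τ i) (1 : K)) ∈ F K n N := by
  rw [adj_eq, ← Finset.add_sum_erase _ _ (Finset.mem_univ τ), if_pos hτ, add_sub_cancel_left]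
  apply Submodule.sum_mem
  intro σ hσ
  split_ifs with hs
  · exact sign_smul_mem _ (mem_F_monomial _ _ (h σ hs (Finset.ne_of_mem_erase hσ)))
  · exact zero_mem _

lemma pexp_one (i : Fin n) : pexp 1 i = mexp i i := by
  simp [pexp, mexp]

lemma pexp_swap (i k : Fin n) (h : i ≠ k) : pexp (Equiv.swap i k) i = mexp i k := by
  have hk : k ∈ Finset.univ.erase i := by simp [Ne.symm h]
  rw [pexp, mexp, if_neg h, ← Finset.sum_erase_add _ _ hk, Equiv.swap_apply_right]
  congr 1
  refine Finset.sum_congr rfl fun a ha => ?_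
  simp only [Finset.mem_erase] at ha
  rw [Equiv.swap_apply_of_ne_of_ne ha.2.1 ha.1]

lemma lead (i k : Fin n) : G K i k - monomial (mexp i k) 1 ∈ F K n (wt (mexp i k)) := by
  unfold G
  split_ifs with h
  · subst h
    have := lead_aux (K := K) i i 1 rfl (wt (mexp i i)) ?_
    · rw [pexp_one] at this
      simpa using this
    · intro σ hi hσ
      rw [← pexp_one, wt_pexp, wt_pexp]
      apply Finset.card_lt_card
      rw [Finset.ssubset_iff_subset_ne]
      refine ⟨fun a => by simp +contextual, fun e => hσ ?_⟩
      ext1 a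
      by_cases ha : a = i
      · rw [ha]; simpa using hi
      · have : a ∈ ((Finset.univ.erase i).filter fun a => σ a = a) := by rw [e]; simp [ha]
        simpa using (Finset.mem_filter.1 this).2
  · have := lead_aux (K := K) i k (Equiv.swap i k) (Equiv.swap_apply_left _ _) (wt (mexp i k)) ?_
    · rw [pexp_swap i k h, Equiv.Perm.sign_swap h] at this
      have := neg_mem this
      simpa [sub_eq_add_neg, add_comm] using this
    · intro σ hi hσ
      rw [← pexp_swap i k h, wt_pexp, wt_pexp]
      have fix : ∀ a, a ≠ i → σ a = a → a ≠ k := by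
        rintro a h1 h2 rfl
        exact h1 (σ.injective (h2.trans hi.symm))
      apply Finset.card_lt_card
      rw [Finset.ssubset_iff_subset_ne]
      refine ⟨fun a => ?_, fun e => hσ ?_⟩
      · simp only [Finset.mem_filter, Finset.mem_erase, Finset.mem_univ, and_true]
        rintro ⟨h1, h2⟩
        exact ⟨h1, Equiv.swap_apply_of_ne_of_ne h1 (fix a h1 h2)⟩
      · have other : ∀ a, a ≠ i → a ≠ k → σ a = a := by
          intro a h1 h2
          have : a ∈ ((Finset.univ.erase i).filter fun a => σ a = a) := by
            rw [e]; simp [h1, Equiv.swap_apply_of_ne_of_ne h1 h2]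
          exact (Finset.mem_filter.1 this).2
        have hk : σ k = i := by
          by_contra hne
          have hne' : σ k ≠ k := fun e' => fix k (Ne.symm h) e' rfl
          exact hne' (σ.injective (other _ hne hne'))
        ext1 a
        by_cases h1 : a = i
        · rw [h1, hi, Equiv.swap_apply_left]
        · by_cases h2 : a = k
          · rw [h2, hk, Equiv.swap_apply_right]
          · rw [other a h1 h2, Equiv.swap_apply_of_ne_of_ne h1 h2]

/-- span of low weight multiples of the generators -/
noncomputable def S (K : Type*) [Field K] (n N : ℕ) : Submodule K (SymPolyRing K n) :=
  Submodule.span K {p | ∃ (v : Sym2 (Fin n) →₀ ℕ) (i k : Fin n),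
    wt (v + mexp i k) < N ∧ p = monomial v 1 * G K i k}

/-- multiple of the generator with leading monomial `u` -/
noncomputable def H (K : Type*) [Field K] (u : Sym2 (Fin n) →₀ ℕ) (i k : Fin n) :
    SymPolyRing K n := monomial (u - mexp i k) 1 * G K i k

lemma H_add (v : Sym2 (Fin n) →₀ ℕ) (i k : Fin n) :
    H K (v + mexp i k) i k = monomial v 1 * G K i k := by
  rw [H, add_tsub_cancel_right]

lemma S_term (t : Sym2 (Fin n) →₀ ℕ) (a j i : Fin n) (ha : a ≠ j) (hj : j ≠ i) {N : ℕ}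
    (hN : wt t + n < N + 2) :
    monomial t 1 * (X s(a, j) * G K j i) ∈ S K n N := by
  apply Submodule.subset_span
  refine ⟨t + Finsupp.single s(a, j) 1, j, i, ?_, ?_⟩
  · have := wt_mexp_ne j i hj
    rw [wt_add, wt_add, wt_single, if_neg ha]
    omega
  · rw [← mul_assoc, MvPolynomial.X, monomial_mul, mul_one]

lemma R1 (u : Sym2 (Fin n) →₀ ℕ) (i k : Fin n) (h : i ≠ k)
    (h1 : mexp i k + Finsupp.single s(k, k) 1 ≤ u) :
    mexp i i ≤ u ∧ H K u i k - H K u i i ∈ S K n (wt u) := by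
  obtain ⟨t, rfl⟩ := exists_add_of_le h1
  have e1 : mexp i k + Finsupp.single s(k, k) 1 + t
      = (t + Finsupp.single s(k, k) 1) + mexp i k := by abel
  have e2 : mexp i k + Finsupp.single s(k, k) 1 + t
      = (t + Finsupp.single s(i, k) 1) + mexp i i := by rw [mexp_add i k h]; abel
  refine ⟨by rw [e2]; exact le_add_self, ?_⟩
  have hw : wt (mexp i k + Finsupp.single s(k, k) 1 + t) + 1 = wt t + n := by
    have := wt_mexp_ne i k h
    rw [wt_add, wt_add, wt_single, if_pos rfl]; omega
  have e3 : H K (mexp i k + Finsupp.single s(k, k) 1 + t) i k =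
      monomial t 1 * (X s(k, k) * G K i k) := by
    rw [e1, H_add, ← mul_assoc, MvPolynomial.X, monomial_mul, mul_one]
  have e4 : H K (mexp i k + Finsupp.single s(k, k) 1 + t) i i =
      monomial t 1 * (X s(i, k) * G K i i) := by
    rw [e2, H_add, ← mul_assoc, MvPolynomial.X, monomial_mul, mul_one]
  have key : X s(k, k) * G K i k - X s(i, k) * G K i i =
      - ∑ j ∈ (Finset.univ.erase i).erase k, X s(k, j) * G K j i := by
    have h0 := congrFun (congrFun (Matrix.mul_adjugate (genericSym K n)) k) i
    rw [Matrix.mul_apply, Matrix.smul_apply, Matrix.one_apply_ne (Ne.symm h), smul_zero,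
      ← Finset.add_sum_erase _ _ (Finset.mem_univ i),
      ← Finset.add_sum_erase _ _ (show k ∈ Finset.univ.erase i by simp [Ne.symm h])] at h0
    have h2 : ∑ j ∈ (Finset.univ.erase i).erase k, X s(k, j) * G K j i =
        - ∑ j ∈ (Finset.univ.erase i).erase k,
          genericSym K n k j * (genericSym K n).adjugate j i := by
      rw [← Finset.sum_neg_distrib]
      refine Finset.sum_congr rfl fun j hj => ?_
      simp only [Finset.mem_erase] at hj
      rw [G, if_neg hj.2.1, mul_neg]; rfl
    rw [h2, G_symm i k, G, if_neg (Ne.symm h), G, if_pos rfl]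
    have g1 : genericSym K n k k = X s(k, k) := rfl
    have g2 : genericSym K n k i = X s(i, k) := by rw [Sym2.eq_swap]; rfl
    rw [g1, g2] at h0
    linear_combination -h0
  rw [e3, e4, ← mul_sub, key, mul_neg, Finset.mul_sum]
  apply neg_mem
  apply Submodule.sum_mem
  intro j hj
  simp only [Finset.mem_erase] at hj
  exact S_term t k j i (Ne.symm hj.1) hj.2.1 (by omega)

lemma det_eq (i : Fin n) : (genericSym K n).det =
    X s(i, i) * G K i i - ∑ j ∈ Finset.univ.erase i, X s(i, j) * G K j i := by
  have h0 := congrFun (congrFun (Matrix.mul_adjugate (genericSym K n)) i) i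
  rw [Matrix.mul_apply, Matrix.smul_apply, Matrix.one_apply_eq, smul_eq_mul, mul_one,
    ← Finset.add_sum_erase _ _ (Finset.mem_univ i)] at h0
  rw [← h0, sub_eq_add_neg, ← Finset.sum_neg_distrib, G, if_pos rfl]
  congr 1
  refine Finset.sum_congr rfl fun j hj => ?_
  rw [G, if_neg (Finset.ne_of_mem_erase hj), mul_neg, neg_neg]; rfl

lemma R2 (u : Sym2 (Fin n) →₀ ℕ) (i k : Fin n)
    (h1 : ∑ j : Fin n, Finsupp.single s(j, j) 1 ≤ u) :
    H K u i i - H K u k k ∈ S K n (wt u) := by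
  obtain ⟨t, rfl⟩ := exists_add_of_le h1
  have hw : wt (∑ j : Fin n, Finsupp.single s(j, j) 1 + t) = wt t + n := by
    rw [wt_add, wt_sum]; simp [wt_single, add_comm]
  have e : ∀ i : Fin n, H K (∑ j : Fin n, Finsupp.single s(j, j) 1 + t) i i =
      monomial t 1 * (genericSym K n).det +
      monomial t 1 * ∑ j ∈ Finset.univ.erase i, X s(i, j) * G K j i := by
    intro i
    have e1 : ∑ j : Fin n, Finsupp.single s(j, j) 1 + t
      = (t + Finsupp.single s(i, i) 1) + mexp i i := by rw [← mexp_diag_add i]; abel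
    rw [e1, H_add, det_eq i, ← mul_add, sub_add_cancel, ← mul_assoc, MvPolynomial.X,
      monomial_mul, mul_one]
  have m : ∀ i : Fin n, monomial t 1 * ∑ j ∈ Finset.univ.erase i, X s(i, j) * G K j i ∈
      S K n (wt (∑ j : Fin n, Finsupp.single s(j, j) 1 + t)) := by
    intro i
    rw [Finset.mul_sum]
    apply Submodule.sum_mem
    intro j hj
    have := Finset.ne_of_mem_erase hj
    exact S_term t i j i (Ne.symm this) this (by omega)
  rw [e i, e k, add_sub_add_left_eq_sub]
  exact sub_mem (m i) (m k)

lemma mexp_apply_diag (i k j : Fin n) (hi : j ≠ i) (hk : j ≠ k) : 1 ≤ mexp i k s(j, j) := by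
  unfold mexp
  split_ifs with h
  · rw [Finsupp.finsetSum_apply]
    refine le_trans ?_ (Finset.single_le_sum (fun _ _ => Nat.zero_le _)
      (show j ∈ Finset.univ.erase i by simp [hi]))
    simp
  · rw [Finsupp.add_apply, Finsupp.finsetSum_apply]
    refine le_trans ?_ (le_trans (Finset.single_le_sum (fun _ _ => Nat.zero_le _)
      (show j ∈ (Finset.univ.erase i).erase k by simp [hi, hk])) (Nat.le_add_right _ _))
    simp

lemma mexp_apply_zero (i k : Fin n) : mexp i k s(k, k) = 0 := by
  unfold mexp
  split_ifs with h
  · rw [Finsupp.finsetSum_apply]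
    refine Finset.sum_eq_zero fun j hj => ?_
    rw [Finsupp.single_apply, if_neg]
    have := Finset.ne_of_mem_erase hj
    simp only [Sym2.eq_iff]
    rintro (⟨rfl, _⟩ | ⟨rfl, _⟩) <;> exact this h.symm
  · rw [Finsupp.add_apply, Finsupp.finsetSum_apply, Finset.sum_eq_zero, Finsupp.single_apply,
      if_neg]
    · rfl
    · simp only [Sym2.eq_iff]
      rintro (⟨rfl, _⟩ | ⟨rfl, _⟩) <;> exact h rfl
    · intro j hj
      rw [Finsupp.single_apply, if_neg]
      have := Finset.ne_of_mem_erase hj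
      simp only [Sym2.eq_iff]
      rintro (⟨rfl, _⟩ | ⟨rfl, _⟩) <;> exact this rfl

lemma mexp_add_le (u : Sym2 (Fin n) →₀ ℕ) (i k : Fin n) (h : mexp i k ≤ u)
    (hk : 1 ≤ u s(k, k)) : mexp i k + Finsupp.single s(k, k) 1 ≤ u := by
  intro a
  rw [Finsupp.add_apply, Finsupp.single_apply]
  split_ifs with e
  · subst e; rw [mexp_apply_zero]; exact hk
  · exact h a

lemma toDiag (u : Sym2 (Fin n) →₀ ℕ) (i k i' k' : Fin n) (h : mexp i k ≤ u)
    (h' : mexp i' k' ≤ u) (hne : s(i, k) ≠ s(i', k')) :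
    ∃ a, mexp a a ≤ u ∧ H K u i k - H K u a a ∈ S K n (wt u) := by
  by_cases hik : i = k
  · subst hik
    exact ⟨i, h, by simp⟩
  · by_cases hk : k ≠ i' ∧ k ≠ k'
    · exact ⟨i, R1 u i k hik (mexp_add_le u i k h
        ((mexp_apply_diag i' k' k hk.1 hk.2).trans (h' _)))⟩
    · have hi : i ≠ i' ∧ i ≠ k' := by
        by_contra hcon
        apply hne
        rw [Sym2.eq_iff]
        grind
      refine ⟨k, ?_⟩
      have e : H K u i k = H K u k i := by rw [H, H, mexp_symm, G_symm]
      rw [e]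
      rw [mexp_symm] at h
      exact R1 u k i (Ne.symm hik) (mexp_add_le u k i h
        ((mexp_apply_diag i' k' i hi.1 hi.2).trans (h' _)))

lemma diag_diag (u : Sym2 (Fin n) →₀ ℕ) (i k : Fin n) (h : mexp i i ≤ u)
    (h' : mexp k k ≤ u) : H K u i i - H K u k k ∈ S K n (wt u) := by
  by_cases hik : i = k
  · subst hik; simp
  · apply R2
    rw [← mexp_diag_add i]
    exact mexp_add_le u i i h ((mexp_apply_diag k k i hik hik).trans (h' _))

lemma agree (u : Sym2 (Fin n) →₀ ℕ) (i k i' k' : Fin n) (h : mexp i k ≤ u)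
    (h' : mexp i' k' ≤ u) : H K u i k - H K u i' k' ∈ S K n (wt u) := by
  by_cases hne : s(i, k) = s(i', k')
  · rcases Sym2.eq_iff.1 hne with ⟨rfl, rfl⟩ | ⟨rfl, rfl⟩
    · simp
    · have e : H K u i k = H K u k i := by rw [H, H, mexp_symm, G_symm]
      rw [e]; simp
  · obtain ⟨a, ha, h1⟩ := toDiag (K := K) u i k i' k' h h' hne
    obtain ⟨b, hb, h2⟩ := toDiag (K := K) u i' k' i k h' h (Ne.symm hne)
    have := sub_mem (add_mem h1 (diag_diag (K := K) u a b ha hb)) h2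
    convert this using 1
    abel

/-- image of a monomial -/
noncomputable def tmon (K : Type*) [Field K] (u : Sym2 (Fin n) →₀ ℕ) : SymPolyRing K n :=
  if h : ∃ g : Fin n × Fin n, mexp g.1 g.2 ≤ u then H K u h.choose.1 h.choose.2
  else monomial u 1

/-- The unipotent deformation. -/
noncomputable def T (K : Type*) [Field K] (n : ℕ) : SymPolyRing K n →ₗ[K] SymPolyRing K n :=
  (MvPolynomial.basisMonomials (Sym2 (Fin n)) K).constr K (tmon K)

lemma T_monomial (u : Sym2 (Fin n) →₀ ℕ) : T K n (monomial u 1) = tmon K u := by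
  have := (MvPolynomial.basisMonomials (Sym2 (Fin n)) K).constr_basis K (tmon K) u
  rwa [MvPolynomial.coe_basisMonomials] at this

lemma T_monomial' (u : Sym2 (Fin n) →₀ ℕ) (c : K) : T K n (monomial u c) = c • tmon K u := by
  rw [← T_monomial, ← map_smul, smul_monomial, smul_eq_mul, mul_one]

lemma tmon_sub (u : Sym2 (Fin n) →₀ ℕ) : tmon K u - monomial u 1 ∈ F K n (wt u) := by
  unfold tmon
  split_ifs with h
  · have hc := h.choose_spec
    set i := h.choose.1
    set k := h.choose.2
    obtain ⟨t, ht⟩ := exists_add_of_le hc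
    rw [add_comm] at ht
    rw [ht, H_add, wt_add]
    have := F_mul t (lead (K := K) i k)
    rwa [mul_sub, monomial_mul, mul_one] at this
  · simp

lemma tmon_homog (u : Sym2 (Fin n) →₀ ℕ) : (tmon K u).IsHomogeneous u.degree := by
  unfold tmon
  split_ifs with h
  · have hc := h.choose_spec
    set i := h.choose.1
    set k := h.choose.2
    obtain ⟨t, ht⟩ := exists_add_of_le hc
    rw [add_comm] at ht
    rw [ht, H_add, map_add, degree_mexp]
    exact (isHomogeneous_monomial _ rfl).mul (homog_G i k)
  · exact isHomogeneous_monomial _ rfl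

lemma T_sub_mem {N : ℕ} {p : SymPolyRing K n} (hp : p ∈ F K n (N + 1)) :
    T K n p - p ∈ F K n N := by
  induction hp using Submodule.span_induction with
  | mem x h =>
    obtain ⟨u, hu, rfl⟩ := h
    simp only [T_monomial]
    exact F_mono (Nat.lt_succ_iff.1 hu) (tmon_sub u)
  | zero => simp
  | add x y _ _ hx hy =>
    rw [map_add, add_sub_add_comm]; exact add_mem hx hy
  | smul a x _ hx => rw [map_smul, ← smul_sub]; exact Submodule.smul_mem _ _ hx

lemma T_inj : Function.Injective (T K n) := by
  rw [injective_iff_map_eq_zero]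
  intro p hp
  obtain ⟨N, hN⟩ := exists_F p
  induction N with
  | zero => exact F_zero hN
  | succ N ih =>
    apply ih
    have := T_sub_mem hN
    rw [hp, zero_sub] at this
    simpa using this

lemma T_comp (d : ℕ) (p : SymPolyRing K n) :
    T K n (homogeneousComponent d p) = homogeneousComponent d (T K n p) := by
  induction p using MvPolynomial.induction_on' with
  | monomial u a =>
    rw [T_monomial', homogeneousComponent_of_mem (isHomogeneous_monomial a rfl), map_smul,
      homogeneousComponent_of_mem (tmon_homog u)]
    split_ifs
    · rw [T_monomial']
    · simp
  | add p q hp hq => simp only [map_add, hp, hq]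

/-- the two ideals -/
noncomputable def Imon (K : Type*) [Field K] (n : ℕ) : Ideal (SymPolyRing K n) :=
  Ideal.span ((fun s => monomial s (1 : K)) '' Set.range fun g : Fin n × Fin n => mexp g.1 g.2)

/-- ideal generated by signed minors -/
noncomputable def Jmin (K : Type*) [Field K] (n : ℕ) : Ideal (SymPolyRing K n) :=
  Ideal.span (Set.range fun g : Fin n × Fin n => G K g.1 g.2)

lemma T_mem {p : SymPolyRing K n} (hp : p ∈ Imon K n) : T K n p ∈ Jmin K n := by
  rw [Imon, mem_ideal_span_monomial_image] at hp
  rw [p.as_sum, map_sum]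
  apply Ideal.sum_mem
  intro u hu
  obtain ⟨_, ⟨g, rfl⟩, hg⟩ := hp u hu
  rw [T_monomial', smul_eq_C_mul]
  apply Ideal.mul_mem_left
  have : ∃ g : Fin n × Fin n, mexp g.1 g.2 ≤ u := ⟨g, hg⟩
  rw [tmon, dif_pos this, H]
  apply Ideal.mul_mem_left
  exact Ideal.subset_span ⟨this.choose, rfl⟩

lemma monomial_mem_Imon {u : Sym2 (Fin n) →₀ ℕ} {i k : Fin n} (h : mexp i k ≤ u) :
    monomial u (1 : K) ∈ Imon K n := by
  rw [Imon, mem_ideal_span_monomial_image]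
  intro v hv
  have := support_monomial_subset hv
  rw [Finset.mem_singleton] at this
  subst this
  exact ⟨_, ⟨(i, k), rfl⟩, h⟩

lemma gen_mem (N : ℕ) : ∀ (v : Sym2 (Fin n) →₀ ℕ) (i k : Fin n), wt (v + mexp i k) = N →
    monomial v 1 * G K i k ∈ Submodule.map (T K n) ((Imon K n).restrictScalars K) := by
  induction N using Nat.strong_induction_on with
  | _ N ih =>
    intro v i k hN
    have hS : S K n (wt (v + mexp i k)) ≤
        Submodule.map (T K n) ((Imon K n).restrictScalars K) := by
      apply Submodule.span_le.2
      rintro _ ⟨v', i', k', hlt, rfl⟩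
      exact ih _ (hN ▸ hlt) v' i' k' rfl
    have hle : mexp i k ≤ v + mexp i k := le_add_self
    have hex : ∃ g : Fin n × Fin n, mexp g.1 g.2 ≤ v + mexp i k := ⟨(i, k), hle⟩
    have h1 := hS (agree (K := K) _ i k _ _ hle hex.choose_spec)
    have h2 : tmon K (v + mexp i k) ∈
        Submodule.map (T K n) ((Imon K n).restrictScalars K) :=
      ⟨monomial (v + mexp i k) 1, monomial_mem_Imon hle, T_monomial _⟩
    rw [tmon, dif_pos hex] at h2
    have := add_mem h1 h2
    rwa [sub_add_cancel, H_add] at this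

lemma map_T : Submodule.map (T K n) ((Imon K n).restrictScalars K) =
    (Jmin K n).restrictScalars K := by
  apply le_antisymm
  · rintro _ ⟨p, hp, rfl⟩
    exact T_mem hp
  · intro p hp
    have hp' : p ∈ Jmin K n := hp
    rw [Jmin, Ideal.mem_span_range_iff_exists_fun] at hp'
    obtain ⟨c, rfl⟩ := hp'
    apply Submodule.sum_mem
    intro g _
    rw [(c g).as_sum, Finset.sum_mul]
    apply Submodule.sum_mem
    intro v _
    have : monomial v (coeff v (c g)) * G K g.1 g.2 =
        coeff v (c g) • (monomial v 1 * G K g.1 g.2) := by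
      rw [← smul_mul_assoc, smul_monomial, smul_eq_mul, mul_one]
    rw [this]
    exact Submodule.smul_mem _ _ (gen_mem _ v g.1 g.2 rfl)

lemma dim_eq (d : ℕ) : idealComponentDim K (Imon K n) d = idealComponentDim K (Jmin K n) d := by
  unfold idealComponentDim
  have : (Jmin K n).restrictScalars K ⊓ homogeneousSubmodule (Sym2 (Fin n)) K d =
      Submodule.map (T K n)
        ((Imon K n).restrictScalars K ⊓ homogeneousSubmodule (Sym2 (Fin n)) K d) := by
    apply le_antisymm
    · rintro p ⟨h1, h2⟩
      rw [← map_T] at h1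
      obtain ⟨q, hq, rfl⟩ := h1
      refine ⟨q, ⟨hq, ?_⟩, rfl⟩
      have h3 : homogeneousComponent d (T K n q) = T K n q := by
        rw [homogeneousComponent_of_mem h2, if_pos rfl]
      rw [← T_comp] at h3
      rw [← T_inj h3]
      exact homogeneousComponent_mem d q
    · rintro _ ⟨q, ⟨h1, h2⟩, rfl⟩
      refine ⟨T_mem h1, ?_⟩
      have h3 : homogeneousComponent d q = q := by
        rw [homogeneousComponent_of_mem h2, if_pos rfl]
      have h4 := T_comp d q
      rw [h3] at h4
      show T K n q ∈ homogeneousSubmodule (Sym2 (Fin n)) K d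
      rw [h4]
      exact homogeneousComponent_mem d _
  rw [this]
  exact (Submodule.equivMapOfInjective (T K n) T_inj _).finrank_eq

lemma exists_succAbove {m : ℕ} (f : Fin m → Fin (m + 1)) (hf : Function.Injective f) :
    ∃ (i : Fin (m + 1)) (σ : Equiv.Perm (Fin m)), f = i.succAbove ∘ σ := by
  have : ¬ Function.Surjective f := by
    intro h
    have := Fintype.card_le_of_surjective f h
    simp at this
  obtain ⟨i, hi⟩ := not_forall.1 this
  have h : ∀ a, ∃ b, i.succAbove b = f a := fun a =>
    Fin.exists_succAbove_eq (fun e => hi ⟨a, e⟩)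
  choose g hg using h
  have gi : Function.Injective g := by
    intro a b e
    apply hf
    rw [← hg, ← hg, e]
  refine ⟨i, Equiv.ofBijective g (Finite.injective_iff_bijective.1 gi), ?_⟩
  ext1 a
  simp [hg]

lemma minors_eq {m : ℕ} : minorsIdeal m (genericSym K (m + 1)) = Jmin K (m + 1) := by
  apply le_antisymm
  · apply Ideal.span_le.2
    rintro _ ⟨f, g, hf, hg, rfl⟩
    obtain ⟨i, σ, rfl⟩ := exists_succAbove f hf
    obtain ⟨k, τ, rfl⟩ := exists_succAbove g hg
    have e1 : (genericSym K (m + 1)).submatrix (i.succAbove ∘ σ) (k.succAbove ∘ τ) =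
        (((genericSym K (m + 1)).submatrix i.succAbove k.succAbove).submatrix σ id).submatrix
          id τ := rfl
    rw [e1, Matrix.det_permute', Matrix.det_permute]
    apply Ideal.mul_mem_left
    apply Ideal.mul_mem_left
    have h1 := Matrix.adjugate_fin_succ_eq_det_submatrix (genericSym K (m + 1)) k i
    have h2 : ((genericSym K (m + 1)).submatrix i.succAbove k.succAbove).det =
        (-1) ^ (i + k : ℕ) * (genericSym K (m + 1)).adjugate k i := by
      rw [h1, ← mul_assoc, ← pow_add, Even.neg_one_pow ⟨_, rfl⟩, one_mul]
    rw [h2]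
    apply Ideal.mul_mem_left
    have h3 : G K k i ∈ Jmin K (m + 1) := Ideal.subset_span ⟨(k, i), rfl⟩
    unfold G at h3
    split_ifs at h3
    · exact h3
    · simpa using h3
  · apply Ideal.span_le.2
    rintro _ ⟨⟨k, i⟩, rfl⟩
    have h1 : (genericSym K (m + 1)).adjugate k i ∈ minorsIdeal m (genericSym K (m + 1)) := by
      rw [Matrix.adjugate_fin_succ_eq_det_submatrix]
      apply Ideal.mul_mem_left
      exact Ideal.subset_span ⟨_, _, Fin.succAbove_right_injective,
        Fin.succAbove_right_injective, rfl⟩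
    simp only [G]
    split_ifs
    · exact h1
    · exact neg_mem h1

lemma Imon_eq : Ideal.span { m : SymPolyRing K n |
        (∃ i : Fin n, m = ∏ j ∈ Finset.univ.erase i, MvPolynomial.X s(j, j)) ∨
        (∃ k l : Fin n, k < l ∧
          m = (∏ j ∈ (Finset.univ.erase k).erase l, MvPolynomial.X s(j, j)) *
            MvPolynomial.X s(k, l)) } = Imon K n := by
  have e1 : ∀ i : Fin n, monomial (mexp i i) (1 : K) =
      ∏ j ∈ Finset.univ.erase i, MvPolynomial.X s(j, j) := by
    intro i
    rw [mexp, if_pos rfl, monomial_sum_one]; rfl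
  have e2 : ∀ k l : Fin n, k ≠ l → monomial (mexp k l) (1 : K) =
      (∏ j ∈ (Finset.univ.erase k).erase l, MvPolynomial.X s(j, j)) *
            MvPolynomial.X s(k, l) := by
    intro k l h
    rw [mexp, if_neg h, ← mul_one (1 : K), ← monomial_mul, monomial_sum_one]; rfl
  unfold Imon
  congr 1
  ext p
  constructor
  · rintro (⟨i, rfl⟩ | ⟨k, l, h, rfl⟩)
    · exact ⟨_, ⟨(i, i), rfl⟩, e1 i⟩
    · exact ⟨_, ⟨(k, l), rfl⟩, e2 k l h.ne⟩
  · rintro ⟨_, ⟨⟨k, l⟩, rfl⟩, rfl⟩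
    rcases lt_trichotomy k l with h | h | h
    · exact Or.inr ⟨k, l, h, e2 k l h.ne⟩
    · subst h
      exact Or.inl ⟨k, e1 k⟩
    · refine Or.inr ⟨l, k, h, ?_⟩
      simp only
      rw [mexp_symm]
      exact e2 l k h.ne

end SymHilb

/-- The squarefree monomial ideal `I` generated by the monomials `(x_{11}⋯x_{nn})/x_{ii}`
for `i = 1,…,n` and `(x_{11}⋯x_{nn})/(x_{kk}x_{ll})·x_{kl}` for `1 ≤ k < l ≤ n` has the
same Hilbert function as the ideal `I_{n-1}(X)` of submaximal minors of the generic
symmetric matrix `X`. -/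
theorem hilbertFunction_diagMonomialIdeal_eq_submaximalMinors
    (K : Type*) [Field K] (n : ℕ) (hn : 2 ≤ n) (d : ℕ) :
    idealComponentDim K
      (Ideal.span { m : SymPolyRing K n |
        (∃ i : Fin n, m = ∏ j ∈ Finset.univ.erase i, MvPolynomial.X s(j, j)) ∨
        (∃ k l : Fin n, k < l ∧
          m = (∏ j ∈ (Finset.univ.erase k).erase l, MvPolynomial.X s(j, j)) *
            MvPolynomial.X s(k, l)) }) d =
    idealComponentDim K (minorsIdeal (n - 1) (genericSym K n)) d := by
  obtain ⟨m, rfl⟩ : ∃ m, n = m + 1 := ⟨n - 1, by omega⟩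
  rw [SymHilb.Imon_eq, Nat.add_sub_cancel, SymHilb.minors_eq]
  exact SymHilb.dim_eq d
end
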